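/- arXiv:1710.00476 — 2 statements merged into one kernel-verified Lean document; each statement's English description precedes it below -/
import Mathlib

section
/- Let d ≥ 1, m ∈ ℝ, and a ∈ S^m_{1,1}. For k ≥ 3 define b_k(x,ξ) := Σ_{j=0}^{k−3} a_{j,k}(x,ξ). Then for every σ > 0 there is a constant C (depending only on σ, d, m, φ and finitely many symbol constants of a, and in particular independent of k, x, and f) such that |T_{b_k} f(x)| ≤ C · 2^{km} · 𝔐_{σ,2^k}(Π*_k f)(x) for all k ≥ 3, all x ∈ ℝ^d, and all Schwartz functions f. -/
noncomputable section

open MeasureTheory SchwartzMap Complex RealInnerProductSpace Filter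
open scoped ENNReal NNReal ContDiff SchwartzMap

/-- Euclidean space `ℝ^d`. -/
abbrev RD (d : ℕ) : Type := EuclideanSpace ℝ (Fin d)

/-- Tempered distributions on `ℝ^d`. -/
abbrev TD (d : ℕ) : Type := 𝓢(RD d, ℂ) →L[ℂ] ℂ

/-- Fourier transform of a Schwartz function (with the convention
`f̂(ξ) = ∫ f(x) e^{-2πi⟨x,ξ⟩} dx`). -/
def fourierS {d : ℕ} (f : 𝓢(RD d, ℂ)) : 𝓢(RD d, ℂ) :=
  SchwartzMap.fourierTransformCLM ℂ f

/-- Hörmander symbol class `S^m_{1,1}`: `a` is smooth and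
`‖∂_ξ^α ∂_x^β a(x,ξ)‖ ≤ c_{α,β} (1+‖ξ‖)^{m-|α|+|β|}` for all orders of derivatives. -/
def IsSymbolS11 (d : ℕ) (m : ℝ) (a : RD d → RD d → ℂ) : Prop :=
  ContDiff ℝ ∞ (fun p : RD d × RD d => a p.1 p.2) ∧
  ∀ α β : ℕ, ∃ c : ℝ, ∀ x ξ : RD d,
    ‖iteratedFDeriv ℝ α (fun ξ' => iteratedFDeriv ℝ β (fun x' => a x' ξ') x) ξ‖
      ≤ c * (1 + ‖ξ‖) ^ (m - (α : ℝ) + (β : ℝ))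

/-- The pseudo-differential operator `T_a f(x) = ∫ a(x,ξ) f̂(ξ) e^{2πi⟨x,ξ⟩} dξ`
acting on a Schwartz function `f`. -/
def pdo {d : ℕ} (a : RD d → RD d → ℂ) (f : 𝓢(RD d, ℂ)) (x : RD d) : ℂ :=
  ∫ ξ, a x ξ * fourierS f ξ * Complex.exp (2 * Real.pi * Complex.I * ((⟪x, ξ⟫ : ℝ) : ℂ))

/-- Littlewood–Paley data: a Schwartz function `φ` with `φ̂` supported in
`{1/2 ≤ |ξ| ≤ 2}` and `Σ_{k∈ℤ} φ̂(2^{-k}ξ) = 1` for `ξ ≠ 0`, together with the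
low-frequency piece `Φ` determined by `Φ̂ = 1 - Σ_{k≥1} φ̂(2^{-k}·)`. -/
structure LPData (d : ℕ) where
  φ : 𝓢(RD d, ℂ)
  Φ : 𝓢(RD d, ℂ)
  supp_φ : ∀ ξ : RD d, fourierS φ ξ ≠ 0 → 1/2 ≤ ‖ξ‖ ∧ ‖ξ‖ ≤ 2
  sum_φ : ∀ ξ : RD d, ξ ≠ 0 → HasSum (fun k : ℤ => fourierS φ ((2:ℝ)^(-k) • ξ)) 1
  Φ_def : ∀ ξ : RD d, fourierS Φ ξ = 1 - ∑' k : ℕ, fourierS φ (((2:ℝ)^(k+1))⁻¹ • ξ)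

/-- The Littlewood–Paley convolution kernel: `Φ` for `k = 0` and
`φ_k = 2^{kd} φ(2^k ·)` for `k ≥ 1`. -/
def LPkernel {d : ℕ} (D : LPData d) : ℕ → RD d → ℂ
  | 0, x => D.Φ x
  | (k+1), x => (((2:ℝ)^((k+1) * d) : ℝ) : ℂ) * D.φ ((2:ℝ)^(k+1) • x)

/-- The Fourier transform of the `k`-th Littlewood–Paley kernel, i.e. `φ̂_k = φ̂(2^{-k}·)`
for `k ≥ 1` and `Φ̂` for `k = 0`. -/
def LPhat {d : ℕ} (D : LPData d) : ℕ → RD d → ℂ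
  | 0, ξ => fourierS D.Φ ξ
  | (k+1), ξ => fourierS D.φ (((2:ℝ)^(k+1))⁻¹ • ξ)

/-- Littlewood–Paley operator `Π_k g = φ_k ∗ g` (with `φ_0 := Φ`) acting on functions. -/
def LP {d : ℕ} (D : LPData d) (k : ℕ) (g : RD d → ℂ) (x : RD d) : ℂ :=
  ∫ y, LPkernel D k y * g (x - y)

/-- `Π*_k = Π_{k-1} + Π_k + Π_{k+1}` (with the convention `φ_{-1} := 0`). -/
def LPstar {d : ℕ} (D : LPData d) (k : ℕ) (g : RD d → ℂ) (x : RD d) : ℂ :=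
  (if k = 0 then 0 else LP D (k-1) g x) + LP D k g x + LP D (k+1) g x

open Classical in
/-- Pairing of a tempered distribution with a plain function: it gives `u ψ` if the
function is (the coercion of) a Schwartz function `ψ`, and `0` otherwise. -/
def pairing {d : ℕ} (u : TD d) (g : RD d → ℂ) : ℂ :=
  if h : ∃ ψ : 𝓢(RD d, ℂ), ⇑ψ = g then u h.choose else 0

/-- Fourier transform of a tempered distribution, `⟨û, ψ⟩ = ⟨u, ψ̂⟩`. -/
def fourierTD {d : ℕ} (u : TD d) : TD d :=
  u.comp (SchwartzMap.fourierTransformCLM ℂ)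

/-- Littlewood–Paley operator on tempered distributions:
`Π_k u (x) = ⟨u, φ_k(x - ·)⟩`. -/
def LPdist {d : ℕ} (D : LPData d) (k : ℕ) (u : TD d) (x : RD d) : ℂ :=
  pairing u (fun y => LPkernel D k (x - y))

/-- The symbol `a_{j,k}(x,ξ) = (φ_j ∗ a(·,ξ))(x) · φ̂_k(ξ)` (with `Φ` replacing `φ_0`). -/
def symbolPiece {d : ℕ} (D : LPData d) (a : RD d → RD d → ℂ) (j k : ℕ)
    (x ξ : RD d) : ℂ :=
  (∫ y, LPkernel D j y * a (x - y) ξ) * LPhat D k ξ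

/-- `T_{a_{j,k}} u (x) = ⟨û, a_{j,k}(x,·) e^{2πi⟨x,·⟩}⟩` for a tempered distribution `u`. -/
def pdoPieceD {d : ℕ} (D : LPData d) (a : RD d → RD d → ℂ) (j k : ℕ)
    (u : TD d) (x : RD d) : ℂ :=
  pairing (fourierTD u)
    (fun ξ => symbolPiece D a j k x ξ * Complex.exp (2 * Real.pi * Complex.I * ((⟪x, ξ⟫ : ℝ) : ℂ)))

/-- Partial sums `Σ_{j=0}^N Σ_{k=0}^N T_{a_{j,k}} u (x)`. -/
def pdoPartial {d : ℕ} (D : LPData d) (a : RD d → RD d → ℂ) (N : ℕ)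
    (u : TD d) (x : RD d) : ℂ :=
  ∑ j ∈ Finset.range (N+1), ∑ k ∈ Finset.range (N+1), pdoPieceD D a j k u x

/-- `T_a u` converges in `S'` to the tempered distribution `Tf`: the partial sums
`Σ_{j,k≤N} T_{a_{j,k}} u` (which are functions) converge to `Tf` weakly. -/
def ConvergesInSPrime {d : ℕ} (D : LPData d) (a : RD d → RD d → ℂ)
    (u : TD d) (Tf : TD d) : Prop :=
  ∀ ψ : 𝓢(RD d, ℂ),
    Tendsto (fun N => ∫ x, pdoPartial D a N u x * ψ x) atTop (nhds (Tf ψ))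

/-- The dyadic cube of level `ν` (side length `2^{-ν}`) indexed by `n ∈ ℤ^d`. -/
def dyadicCube (d : ℕ) (ν : ℤ) (n : Fin d → ℤ) : Set (RD d) :=
  {x | ∀ i, (n i : ℝ) * (2:ℝ)^(-ν) ≤ x i ∧ x i < ((n i : ℝ) + 1) * (2:ℝ)^(-ν)}

/-- The local quantity `(|P|⁻¹ ∫_P Σ_{k=k₀}^∞ 2^{skq} ‖g_k(x)‖^q dx)^{1/q}` for the
dyadic cube `P` of level `μ` indexed by `n` (so that `|P|⁻¹ = 2^{μd}`). -/
def cubePiece (d : ℕ) (μ : ℕ) (n : Fin d → ℤ) (k₀ : ℕ) (s q : ℝ)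
    (g : ℕ → RD d → ℂ) : ℝ≥0∞ :=
  ((2:ℝ≥0∞)^((μ:ℝ)*(d:ℝ)) *
    ∫⁻ x in dyadicCube d μ n,
      ∑' j : ℕ, (2:ℝ≥0∞)^(s*((k₀:ℝ)+(j:ℝ))*q) * (‖g (k₀+j) x‖₊ : ℝ≥0∞)^q) ^ (1/q)

/-- The `F_∞^{s,q}` norm (for `q < ∞`) of a function, computed from its
Littlewood–Paley pieces:
`‖Π_0 g‖_∞ + sup_{l(P)<1 dyadic} (|P|⁻¹ ∫_P Σ_{k=-log₂ l(P)}^∞ 2^{skq}|Π_k g|^q)^{1/q}`. -/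
def FinftyNormFun {d : ℕ} (D : LPData d) (s q : ℝ) (g : RD d → ℂ) : ℝ≥0∞ :=
  (⨆ x : RD d, (‖LP D 0 g x‖₊ : ℝ≥0∞)) +
  ⨆ (μ : ℕ) (_ : 1 ≤ μ) (n : Fin d → ℤ),
    cubePiece d μ n μ s q (fun k x => LP D k g x)

/-- The `F_∞^{s,q}` norm (for `q < ∞`) of a tempered distribution. -/
def FinftyNormDist {d : ℕ} (D : LPData d) (s q : ℝ) (u : TD d) : ℝ≥0∞ :=
  (⨆ x : RD d, (‖LPdist D 0 u x‖₊ : ℝ≥0∞)) +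
  ⨆ (μ : ℕ) (_ : 1 ≤ μ) (n : Fin d → ℤ),
    cubePiece d μ n μ s q (fun k x => LPdist D k u x)

/-- The (axis-parallel, closed) cube with corner `c` and side length `L`. -/
def cube (d : ℕ) (c : RD d) (L : ℝ) : Set (RD d) :=
  {x | ∀ i, c i ≤ x i ∧ x i ≤ c i + L}

/-- The average of `g` over the cube with corner `c` and side length `L`. -/
def cubeMean {d : ℕ} (c : RD d) (L : ℝ) (g : RD d → ℂ) : ℂ :=
  (L^d)⁻¹ • ∫ x in cube d c L, g x

/-- The `bmo` norm (local BMO):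
`sup_{l(Q)≥1} |Q|⁻¹∫_Q |g| + sup_{l(Q)<1} |Q|⁻¹∫_Q |g - g_Q|`, over all cubes `Q`. -/
def bmoNorm (d : ℕ) (g : RD d → ℂ) : ℝ≥0∞ :=
  (⨆ (c : RD d) (L : ℝ) (_ : 1 ≤ L),
    ENNReal.ofReal ((L^d)⁻¹) * ∫⁻ x in cube d c L, (‖g x‖₊ : ℝ≥0∞)) +
  (⨆ (c : RD d) (L : ℝ) (_ : 0 < L) (_ : L < 1),
    ENNReal.ofReal ((L^d)⁻¹) * ∫⁻ x in cube d c L, (‖g x - cubeMean c L g‖₊ : ℝ≥0∞))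

/-- The Peetre maximal function `𝔐_{σ,R} g(x) = sup_y ‖g(x-y)‖/(1+R‖y‖)^σ`. -/
def peetre {d : ℕ} (σ R : ℝ) (g : RD d → ℂ) (x : RD d) : ℝ≥0∞ :=
  ⨆ y : RD d, (‖g (x - y)‖₊ : ℝ≥0∞) / ENNReal.ofReal ((1 + R * ‖y‖) ^ σ)

/-- `g` has (distributional) Fourier support contained in `K`: the pairing
`⟨ĝ, ψ⟩ = ∫ g · ψ̂` vanishes for every Schwartz `ψ` whose support does not meet `K`. -/
def HasFourierSupportIn {d : ℕ} (g : RD d → ℂ) (K : Set (RD d)) : Prop :=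
  ∀ ψ : 𝓢(RD d, ℂ), tsupport ⇑ψ ∩ K = ∅ → ∫ x, g x * fourierS ψ x = 0

/-- `b_k(x,ξ) = Σ_{j=0}^{k-3} a_{j,k}(x,ξ)` (for `k ≥ 3`). -/
def bsym {d : ℕ} (D : LPData d) (a : RD d → RD d → ℂ) (k : ℕ) (x ξ : RD d) : ℂ :=
  ∑ j ∈ Finset.range (k-2), symbolPiece D a j k x ξ

open FourierTransform

/-- Scaling behaviour of the Fourier transform on `ℝ^d`. -/
lemma fourier_comp_smul {d : ℕ} (f : RD d → ℂ) {t : ℝ} (ht : 0 < t) (ξ : RD d) :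
    𝓕 (fun x => f (t • x)) ξ = (((t ^ d)⁻¹ : ℝ) : ℂ) * 𝓕 f (t⁻¹ • ξ) := by
  have h := Measure.integral_comp_smul_of_nonneg (volume : Measure (RD d))
    (fun v => Real.fourierChar (-⟪v, t⁻¹ • ξ⟫) • f v) t (hR := ht.le)
  rw [finrank_euclideanSpace_fin] at h
  rw [Real.fourier_eq, Real.fourier_eq, ← Complex.real_smul, ← h]
  simp only [real_inner_smul_left, real_inner_smul_right, inv_mul_cancel_left₀ ht.ne']

/-- The Schwartz function `x ↦ f (t • x)`. -/
def dilate {d : ℕ} (t : ℝ) (ht : 0 < t) (f : 𝓢(RD d, ℂ)) : 𝓢(RD d, ℂ) :=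
  SchwartzMap.compCLMOfContinuousLinearEquiv ℂ
    (ContinuousLinearEquiv.smulLeft (Units.mk0 t ht.ne')) f

lemma fourier_dilate_apply {d : ℕ} {t : ℝ} (ht : 0 < t) (f : 𝓢(RD d, ℂ)) (ξ : RD d) :
    𝓕 (dilate t ht f) ξ = (((t ^ d)⁻¹ : ℝ) : ℂ) * 𝓕 f (t⁻¹ • ξ) :=
  fourier_comp_smul (⇑f) ht ξ

lemma fourierS_eq {d : ℕ} (f : 𝓢(RD d, ℂ)) : fourierS f = 𝓕 f := rfl

lemma LPData.fourierS_zero {d : ℕ} (D : LPData d) : fourierS D.φ 0 = 0 := by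
  by_contra h
  have := (D.supp_φ 0 h).1
  norm_num at this

lemma LPData.summable {d : ℕ} (D : LPData d) (ξ : RD d) :
    Summable (fun k : ℕ => fourierS D.φ (((2 : ℝ) ^ k)⁻¹ • ξ)) := by
  by_cases hξ : ξ = 0
  · simp [hξ, D.fourierS_zero]
  · have h := (D.sum_φ ξ hξ).summable.comp_injective (i := fun k : ℕ => (k : ℤ))
      Nat.cast_injective
    simpa [Function.comp_def] using h

/-- `Φ̂(2ξ) = Φ̂(ξ) - φ̂(ξ)`. -/
lemma LPData.fourierS_Φ_two_smul {d : ℕ} (D : LPData d) (ξ : RD d) :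
    fourierS D.φ ξ + fourierS D.Φ ((2 : ℝ) • ξ) = fourierS D.Φ ξ := by
  have h := (D.summable ξ).tsum_eq_zero_add
  have e : ∀ k : ℕ, ((2 : ℝ) ^ (k + 1))⁻¹ • (2 : ℝ) • ξ = ((2 : ℝ) ^ k)⁻¹ • ξ := fun k => by
    rw [smul_smul]; congr 1; field_simp; ring
  rw [D.Φ_def, D.Φ_def]
  simp only [e, h, pow_zero, inv_one, one_smul]
  ring

/-- `2^d φ(2 y) + Φ(y) = 2^d Φ(2 y)`. -/
lemma LPData.two_scale {d : ℕ} (D : LPData d) (y : RD d) :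
    (((2 : ℝ) ^ d : ℝ) : ℂ) * D.φ ((2 : ℝ) • y) + D.Φ y
      = (((2 : ℝ) ^ d : ℝ) : ℂ) * D.Φ ((2 : ℝ) • y) := by
  have h : (((2 : ℝ) ^ d : ℝ) : ℂ) • dilate 2 two_pos D.φ + D.Φ
      = (((2 : ℝ) ^ d : ℝ) : ℂ) • dilate 2 two_pos D.Φ := by
    apply (FourierTransform.fourierEquiv ℂ 𝓢(RD d, ℂ)).injective
    ext ξ
    have hs := D.fourierS_Φ_two_smul ((2 : ℝ)⁻¹ • ξ)
    rw [smul_inv_smul₀ two_ne_zero, fourierS_eq, fourierS_eq] at hs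
    simp only [FourierTransform.fourierEquiv_apply, FourierTransform.fourier_add,
      FourierTransform.fourier_smul, add_apply, smul_apply,
      fourier_dilate_apply, smul_eq_mul, ← hs]
    have h2 : (((2 : ℝ) ^ d : ℝ) : ℂ) ≠ 0 := by simp
    push_cast at h2 ⊢
    field_simp
  exact congrArg (fun g : 𝓢(RD d, ℂ) => g y) h

/-- The sum of the first kernels telescopes to a dilate of `Φ`. -/
lemma sum_LPkernel {d : ℕ} (D : LPData d) (n : ℕ) (y : RD d) :
    ∑ j ∈ Finset.range (n + 1), LPkernel D j y
      = (((2 : ℝ) ^ (n * d) : ℝ) : ℂ) * D.Φ ((2 : ℝ) ^ n • y) := by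
  induction n with
  | zero => simp [LPkernel]
  | succ n ih =>
    have h := D.two_scale ((2 : ℝ) ^ n • y)
    rw [smul_smul, ← pow_succ'] at h
    rw [Finset.sum_range_succ, ih, LPkernel]
    rw [add_mul, one_mul, pow_add]
    push_cast at h ⊢
    linear_combination ((2 : ℂ) ^ (n * d)) * h

lemma exists_schwartz_LPkernel {d : ℕ} (D : LPData d) (k : ℕ) :
    ∃ κ : 𝓢(RD d, ℂ), ⇑κ = LPkernel D k ∧ ⇑(fourierS κ) = LPhat D k := by
  cases k with
  | zero => exact ⟨D.Φ, rfl, rfl⟩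
  | succ k =>
    have h2 : (0 : ℝ) < 2 ^ (k + 1) := by positivity
    refine ⟨(((2 : ℝ) ^ ((k + 1) * d) : ℝ) : ℂ) • dilate _ h2 D.φ, ?_, ?_⟩
    · ext x; rfl
    · ext ξ
      rw [fourierS_eq, FourierTransform.fourier_smul, smul_apply, fourier_dilate_apply, LPhat,
        fourierS_eq, smul_eq_mul, ← mul_assoc, ← Complex.ofReal_mul, ← pow_mul,
        mul_inv_cancel₀ (by positivity), Complex.ofReal_one, one_mul]

/-- `Π_k f` is a Schwartz function with Fourier transform `φ̂_k f̂`. -/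
lemma exists_schwartz_LP {d : ℕ} (D : LPData d) (k : ℕ) (f : 𝓢(RD d, ℂ)) :
    ∃ h : 𝓢(RD d, ℂ), ⇑h = LP D k f ∧ ∀ ξ, 𝓕 h ξ = LPhat D k ξ * 𝓕 f ξ := by
  obtain ⟨κ, hκ, hκ'⟩ := exists_schwartz_LPkernel D k
  refine ⟨SchwartzMap.convolution (ContinuousLinearMap.mul ℂ ℂ) κ f, ?_, fun ξ => ?_⟩
  · ext x
    rw [SchwartzMap.convolution_apply]
    simp [MeasureTheory.convolution, LP, hκ]
  · rw [SchwartzMap.fourier_convolution, ← hκ']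
    rfl

/-- `Π*_k f` is a Schwartz function with Fourier transform `(φ̂_{k-1} + φ̂_k + φ̂_{k+1}) f̂`. -/
lemma exists_schwartz_LPstar {d : ℕ} (D : LPData d) {k : ℕ} (hk : k ≠ 0) (f : 𝓢(RD d, ℂ)) :
    ∃ h : 𝓢(RD d, ℂ), ⇑h = LPstar D k f ∧
      ∀ ξ, 𝓕 h ξ = (LPhat D (k - 1) ξ + LPhat D k ξ + LPhat D (k + 1) ξ) * 𝓕 f ξ := by
  obtain ⟨h₁, e₁, f₁⟩ := exists_schwartz_LP D (k - 1) f
  obtain ⟨h₂, e₂, f₂⟩ := exists_schwartz_LP D k f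
  obtain ⟨h₃, e₃, f₃⟩ := exists_schwartz_LP D (k + 1) f
  refine ⟨h₁ + h₂ + h₃, ?_, fun ξ => ?_⟩
  · ext x
    simp [LPstar, hk, ← e₁, ← e₂, ← e₃]
  · simp only [FourierTransform.fourier_add, add_apply, f₁, f₂, f₃]
    ring

/-- By continuity, `φ̂` is supported in the open annulus. -/
lemma LPData.norm_mem_Ioo {d : ℕ} (D : LPData d) {ξ : RD d} (h : fourierS D.φ ξ ≠ 0) :
    1 / 2 < ‖ξ‖ ∧ ‖ξ‖ < 2 := by
  have hc : ContinuousAt (fun t : ℝ => fourierS D.φ (t • ξ)) 1 := by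
    have : Continuous (fun t : ℝ => fourierS D.φ (t • ξ)) :=
      (fourierS D.φ).continuous.comp (by fun_prop)
    exact this.continuousAt
  have hev : ∀ᶠ t : ℝ in nhds 1, fourierS D.φ (t • ξ) ≠ 0 :=
    hc.eventually_ne (by simpa using h)
  have h0 : 0 < ‖ξ‖ := lt_of_lt_of_le (by norm_num) (D.supp_φ ξ h).1
  obtain ⟨ε, hε, hball⟩ := Metric.eventually_nhds_iff.1 hev
  have hp : dist (1 + ε / 2) 1 < ε := by
    rw [Real.dist_eq, add_sub_cancel_left, abs_of_pos (by positivity)]; linarith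
  have hm : dist (1 - ε / 2) 1 < ε := by
    rw [Real.dist_eq, sub_sub_cancel_left, abs_neg, abs_of_pos (by positivity)]; linarith
  have hm' : dist (max (1 - ε / 2) 0) 1 < ε := by
    rw [Real.dist_eq] at hm ⊢
    refine lt_of_le_of_lt ?_ hm
    rcases le_total (1 - ε / 2) 0 with h | h
    · rw [max_eq_right h, abs_of_nonpos (by norm_num), abs_of_nonpos (by linarith)]; linarith
    · rw [max_eq_left h]
  have A := (D.supp_φ _ (hball hp)).2
  have B := (D.supp_φ _ (hball hm')).1
  rw [norm_smul, Real.norm_eq_abs, abs_of_pos (by positivity)] at A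
  rw [norm_smul, Real.norm_eq_abs, abs_of_nonneg (le_max_right _ _)] at B
  have : max (1 - ε / 2) 0 < 1 := max_lt (by linarith) one_pos
  constructor <;> nlinarith

/-- `φ̂_{k-1} + φ̂_k + φ̂_{k+1} = 1` on the support of `φ̂_k`. -/
lemma LPhat_star_eq_one {d : ℕ} (D : LPData d) {k : ℕ} (hk : 2 ≤ k) {ξ : RD d}
    (h : LPhat D k ξ ≠ 0) :
    LPhat D (k - 1) ξ + LPhat D k ξ + LPhat D (k + 1) ξ = 1 := by
  have e : ∀ j : ℕ, j ≠ 0 → LPhat D j ξ = fourierS D.φ ((2 : ℝ) ^ (-(j : ℤ)) • ξ) := by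
    intro j hj
    obtain ⟨i, rfl⟩ := Nat.exists_eq_succ_of_ne_zero hj
    rw [LPhat, zpow_neg, zpow_natCast]
  have key : ∀ j : ℤ, fourierS D.φ ((2 : ℝ) ^ (-j) • ξ) ≠ 0 →
      (2 : ℝ) ^ (j - 1) < ‖ξ‖ ∧ ‖ξ‖ < (2 : ℝ) ^ (j + 1) := by
    intro j hj
    have := D.norm_mem_Ioo hj
    have hp : (0 : ℝ) < 2 ^ j := by positivity
    rw [norm_smul, norm_zpow, Real.norm_two, zpow_neg, inv_mul_eq_div, lt_div_iff₀ hp,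
      div_lt_iff₀ hp] at this
    rw [zpow_sub_one₀ two_ne_zero, zpow_add_one₀ two_ne_zero]
    constructor <;> linarith
  rw [e k (by omega)] at h
  obtain ⟨hk1, hk2⟩ := key k h
  have hξ : ξ ≠ 0 := by
    rintro rfl
    simp [D.fourierS_zero] at h
  have hs := (D.sum_φ ξ hξ).unique (hasSum_sum_of_ne_finset_zero
    (s := {(k : ℤ) - 1, (k : ℤ), (k : ℤ) + 1}) (fun j hj => by
      by_contra hne
      obtain ⟨h1, h2⟩ := key j hne
      have a1 := (zpow_lt_zpow_iff_right₀ (one_lt_two (α := ℝ))).1 (h1.trans hk2)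
      have a2 := (zpow_lt_zpow_iff_right₀ (one_lt_two (α := ℝ))).1 (hk1.trans h2)
      simp only [Finset.mem_insert, Finset.mem_singleton] at hj
      omega))
  rw [Finset.sum_insert (by simp; omega), Finset.sum_insert (by simp), Finset.sum_singleton] at hs
  rw [e _ (by omega), e k (by omega), e (k + 1) (by omega), hs]
  push_cast [Nat.cast_sub (show 1 ≤ k by omega)]
  ring

/-- Quantitative decay of the Fourier transform of a smooth function supported in a ball. -/
lemma exists_fourier_decay (d n : ℕ) : ∃ A : ℝ, ∀ (G : 𝓢(RD d, ℂ)) (B : ℝ),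
    tsupport ⇑G ⊆ Metric.closedBall 0 2 →
    (∀ i ≤ n, ∀ v, ‖iteratedFDeriv ℝ i ⇑G v‖ ≤ B) →
    ∀ y, (1 + ‖y‖) ^ n * ‖𝓕 G y‖ ≤ A * B := by
  set V := (volume : Measure (RD d)).real (Metric.closedBall 0 2) with hV
  have hVfin : (volume : Measure (RD d)) (Metric.closedBall 0 2) ≠ ⊤ :=
    measure_closedBall_lt_top.ne
  refine ⟨2 ^ (n - 1) * (V + 2 ^ n * ((n + 1) * V)), fun G B hsupp hB y => ?_⟩
  have hint : ∀ i ≤ n, ∫ v, ‖iteratedFDeriv ℝ i ⇑G v‖ ≤ B * V := by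
    intro i hi
    have h0 : ∀ v, v ∉ Metric.closedBall (0 : RD d) 2 → ‖iteratedFDeriv ℝ i ⇑G v‖ = 0 := by
      intro v hv
      rw [norm_eq_zero]
      by_contra h
      exact hv (hsupp (support_iteratedFDeriv_subset i h))
    rw [← setIntegral_eq_integral_of_forall_compl_eq_zero h0]
    calc _ ≤ ‖∫ v in Metric.closedBall (0 : RD d) 2, ‖iteratedFDeriv ℝ i ⇑G v‖‖ :=
          Real.le_norm_self _
      _ ≤ B * V := norm_setIntegral_le_of_norm_le_const hVfin.lt_top
          (fun v _ => by simpa using hB i hi v)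
  have hdec : ∀ N ≤ n, ‖y‖ ^ N * ‖𝓕 G y‖ ≤ 2 ^ N * ((N + 1) * (B * V)) := by
    intro N hN
    have h := Real.pow_mul_norm_iteratedFDeriv_fourier_le (f := ⇑G) (K := ⊤) (N := ⊤)
      (G.smooth _) (fun k n _ _ => G.integrable_pow_mul_iteratedFDeriv volume k n)
      (k := 0) (n := N) le_top le_top y
    rw [norm_iteratedFDeriv_zero] at h
    refine h.trans ?_
    simp only [pow_zero, one_mul, Nat.cast_zero, mul_zero, zero_add]
    gcongr
    calc _ ≤ ∑ p ∈ Finset.range 1 ×ˢ Finset.range (N + 1), B * V := by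
          refine Finset.sum_le_sum fun p hp => ?_
          obtain ⟨h1, h2⟩ := Finset.mem_product.1 hp
          rw [Finset.mem_range] at h1 h2
          obtain ⟨p1, p2⟩ := p
          obtain rfl : p1 = 0 := by simpa using h1
          simpa using hint p2 (by simp at h2; omega)
      _ = (N + 1) * (B * V) := by simp
  calc (1 + ‖y‖) ^ n * ‖𝓕 G y‖ ≤ (2 ^ (n - 1) * (1 ^ n + ‖y‖ ^ n)) * ‖𝓕 G y‖ := by
        gcongr
        exact add_pow_le zero_le_one (norm_nonneg _) n
    _ = 2 ^ (n - 1) * (‖y‖ ^ 0 * ‖𝓕 G y‖ + ‖y‖ ^ n * ‖𝓕 G y‖) := by ring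
    _ ≤ 2 ^ (n - 1) * (2 ^ 0 * (((0 : ℕ) + 1) * (B * V)) + 2 ^ n * ((n + 1) * (B * V))) :=
        mul_le_mul_of_nonneg_left (add_le_add (hdec 0 (Nat.zero_le n)) (hdec n le_rfl))
          (by positivity)
    _ = _ := by push_cast; ring

lemma rpow_le_three_rpow_abs {t : ℝ} (h1 : 1 / 2 ≤ t) (h2 : t ≤ 3) (s : ℝ) :
    t ^ s ≤ (3 : ℝ) ^ |s| := by
  rcases le_total 0 s with hs | hs
  · rw [abs_of_nonneg hs]
    exact Real.rpow_le_rpow (by linarith) h2 hs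
  · rw [abs_of_nonpos hs]
    have ht : t⁻¹ ≤ 3 := by
      rw [inv_le_comm₀ (by linarith) (by norm_num)]; linarith
    rw [← neg_neg s, Real.rpow_neg (by linarith), neg_neg,
      ← Real.inv_rpow (by linarith)]
    exact Real.rpow_le_rpow (by positivity) ht (by linarith)

lemma IsSymbolS11.contDiff_snd {d : ℕ} {m : ℝ} {a : RD d → RD d → ℂ} (ha : IsSymbolS11 d m a)
    (u : RD d) : ContDiff ℝ ∞ (a u) :=
  ha.1.comp (contDiff_prodMk_right u)

lemma IsSymbolS11.norm_iteratedFDeriv_le {d : ℕ} {m : ℝ} {a : RD d → RD d → ℂ}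
    (ha : IsSymbolS11 d m a) (α : ℕ) :
    ∃ c : ℝ, 0 ≤ c ∧ ∀ u ξ, ‖iteratedFDeriv ℝ α (a u) ξ‖ ≤ c * (1 + ‖ξ‖) ^ (m - α) := by
  obtain ⟨c, hc⟩ := ha.2 α 0
  refine ⟨|c|, abs_nonneg c, fun u ξ => ?_⟩
  have h := hc u ξ
  have e : (fun ξ' => iteratedFDeriv ℝ 0 (fun x' => a x' ξ') u)
      = (continuousMultilinearCurryFin0 ℝ (RD d) ℂ).symm ∘ a u := by
    ext ξ'; simp
  rw [e, LinearIsometryEquiv.norm_iteratedFDeriv_comp_left, Nat.cast_zero, add_zero] at h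
  refine h.trans ?_
  gcongr
  exact le_abs_self c

/-- Derivatives of the dilated symbol `a(u, 2^k ·)` on the annulus `1/2 ≤ |v| ≤ 2`. -/
lemma IsSymbolS11.norm_iteratedFDeriv_dilate_le {d : ℕ} {m : ℝ} {a : RD d → RD d → ℂ}
    (ha : IsSymbolS11 d m a) (α : ℕ) :
    ∃ c : ℝ, 0 ≤ c ∧ ∀ (u : RD d) (k : ℕ) (v : RD d), 1 / 2 ≤ ‖v‖ → ‖v‖ ≤ 2 →
      ‖iteratedFDeriv ℝ α (fun η => a u ((2 : ℝ) ^ k • η)) v‖ ≤ c * (2 : ℝ) ^ ((k : ℝ) * m) := by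
  obtain ⟨c, hc0, hc⟩ := ha.norm_iteratedFDeriv_le α
  refine ⟨c * 3 ^ |m - α|, by positivity, fun u k v hv1 hv2 => ?_⟩
  have h1 : ContDiff ℝ α (a u) := (ha.contDiff_snd u).of_le (mod_cast le_top)
  rw [iteratedFDeriv_comp_const_smul _ h1]
  have hk : (1 : ℝ) ≤ 2 ^ k := one_le_pow₀ one_le_two
  have hk0 : (0 : ℝ) < 2 ^ k := by positivity
  have ht : 1 + ‖(2 : ℝ) ^ k • v‖ = 2 ^ k * (((2 : ℝ) ^ k)⁻¹ + ‖v‖) := by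
    rw [norm_smul, norm_pow, Real.norm_two]; field_simp
  have hinv : ((2 : ℝ) ^ k)⁻¹ ≤ 1 := inv_le_one_of_one_le₀ hk
  have hinv0 : 0 < ((2 : ℝ) ^ k)⁻¹ := by positivity
  have hpow : ((2 : ℝ) ^ k) ^ α * ((2 : ℝ) ^ k) ^ (m - α) = (2 : ℝ) ^ ((k : ℝ) * m) := by
    rw [← Real.rpow_natCast ((2 : ℝ) ^ k) α, ← Real.rpow_add hk0, ← Real.rpow_natCast 2 k,
      ← Real.rpow_mul zero_le_two]
    congr 1; ring
  calc ‖((2 : ℝ) ^ k) ^ α • iteratedFDeriv ℝ α (a u) ((2 : ℝ) ^ k • v)‖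
      ≤ ((2 : ℝ) ^ k) ^ α * (c * (1 + ‖(2 : ℝ) ^ k • v‖) ^ (m - α)) := by
        rw [norm_smul, norm_pow, norm_pow, Real.norm_two]
        gcongr
        exact hc _ _
    _ = c * (((2 : ℝ) ^ k)⁻¹ + ‖v‖) ^ (m - α) * (2 : ℝ) ^ ((k : ℝ) * m) := by
        rw [ht, Real.mul_rpow hk0.le (by positivity), ← hpow]; ring
    _ ≤ _ := by
        gcongr
        exact rpow_le_three_rpow_abs (by linarith) (by linarith) _

lemma LPData.tsupport_subset {d : ℕ} (D : LPData d) {v : RD d}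
    (hv : v ∈ tsupport ⇑(fourierS D.φ)) : 1 / 2 ≤ ‖v‖ ∧ ‖v‖ ≤ 2 := by
  have hc : IsClosed {v : RD d | 1 / 2 ≤ ‖v‖ ∧ ‖v‖ ≤ 2} :=
    (isClosed_le continuous_const continuous_norm).inter
      (isClosed_le continuous_norm continuous_const)
  exact closure_minimal (fun ξ hξ => D.supp_φ ξ hξ) hc hv

/-- The rescaled localized symbol `η ↦ a(u, 2^k η) φ̂(η)`. -/
def localSymbol {d : ℕ} (D : LPData d) (a : RD d → RD d → ℂ) (u : RD d) (k : ℕ) (η : RD d) : ℂ :=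
  a u ((2 : ℝ) ^ k • η) * fourierS D.φ η

lemma tsupport_localSymbol {d : ℕ} (D : LPData d) (a : RD d → RD d → ℂ) (u : RD d) (k : ℕ) :
    tsupport (localSymbol D a u k) ⊆ tsupport ⇑(fourierS D.φ) :=
  tsupport_mul_subset_right

lemma tsupport_localSymbol_subset_closedBall {d : ℕ} (D : LPData d) (a : RD d → RD d → ℂ)
    (u : RD d) (k : ℕ) : tsupport (localSymbol D a u k) ⊆ Metric.closedBall 0 2 := fun v hv => by
  simpa using (D.tsupport_subset (tsupport_localSymbol D a u k hv)).2

lemma hasCompactSupport_localSymbol {d : ℕ} (D : LPData d) (a : RD d → RD d → ℂ) (u : RD d)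
    (k : ℕ) : HasCompactSupport (localSymbol D a u k) :=
  (isCompact_closedBall 0 2).of_isClosed_subset (isClosed_tsupport _)
    (tsupport_localSymbol_subset_closedBall D a u k)

lemma contDiff_localSymbol {d : ℕ} (D : LPData d) {m : ℝ} {a : RD d → RD d → ℂ}
    (ha : IsSymbolS11 d m a) (u : RD d) (k : ℕ) : ContDiff ℝ ∞ (localSymbol D a u k) :=
  ((ha.contDiff_snd u).comp (contDiff_const_smul _)).mul ((fourierS D.φ).smooth _)

lemma norm_iteratedFDeriv_localSymbol_le {d : ℕ} (D : LPData d) {m : ℝ} {a : RD d → RD d → ℂ}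
    (ha : IsSymbolS11 d m a) (i : ℕ) :
    ∃ B : ℝ, 0 ≤ B ∧ ∀ (u : RD d) (k : ℕ) (v : RD d),
      ‖iteratedFDeriv ℝ i (localSymbol D a u k) v‖ ≤ B * (2 : ℝ) ^ ((k : ℝ) * m) := by
  choose c hc0 hc using ha.norm_iteratedFDeriv_dilate_le
  refine ⟨∑ l ∈ Finset.range (i + 1), (i.choose l : ℝ) * c l *
    SchwartzMap.seminorm ℝ 0 (i - l) (fourierS D.φ), ?_, fun u k v => ?_⟩
  · exact Finset.sum_nonneg fun l _ => mul_nonneg (mul_nonneg (by positivity) (hc0 l))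
      (apply_nonneg _ _)
  by_cases hv : v ∈ tsupport ⇑(fourierS D.φ)
  · obtain ⟨h1, h2⟩ := D.tsupport_subset hv
    refine (norm_iteratedFDeriv_mul_le (N := ∞)
      ((ha.contDiff_snd u).comp (contDiff_const_smul _)) ((fourierS D.φ).smooth _) v
      (mod_cast le_top)).trans ?_
    rw [Finset.sum_mul]
    refine Finset.sum_le_sum fun l _ => ?_
    calc _ ≤ (i.choose l : ℝ) * (c l * (2 : ℝ) ^ ((k : ℝ) * m)) *
          SchwartzMap.seminorm ℝ 0 (i - l) (fourierS D.φ) := by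
          gcongr
          · exact mul_nonneg (by positivity) (mul_nonneg (hc0 l) (by positivity))
          · exact hc l u k v h1 h2
          · exact SchwartzMap.norm_iteratedFDeriv_le_seminorm ℝ (fourierS D.φ) (i - l) v
      _ = _ := by ring
  · have : iteratedFDeriv ℝ i (localSymbol D a u k) v = 0 := by
      by_contra h
      exact hv (tsupport_localSymbol D a u k (support_iteratedFDeriv_subset i h))
    rw [this, norm_zero]
    refine mul_nonneg (Finset.sum_nonneg fun l _ => mul_nonneg (mul_nonneg (by positivity) (hc0 l))
      (apply_nonneg _ _)) (by positivity)

/-- Uniform decay of the Fourier transforms of the rescaled localized symbols. -/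
lemma exists_fourier_localSymbol_decay {d : ℕ} (D : LPData d) {m : ℝ} {a : RD d → RD d → ℂ}
    (ha : IsSymbolS11 d m a) (n : ℕ) :
    ∃ A : ℝ, ∀ (u : RD d) (k : ℕ) (y : RD d),
      (1 + ‖y‖) ^ n * ‖𝓕 (localSymbol D a u k) y‖ ≤ A * (2 : ℝ) ^ ((k : ℝ) * m) := by
  obtain ⟨A, hA⟩ := exists_fourier_decay d n
  choose B hB0 hB using norm_iteratedFDeriv_localSymbol_le D ha
  refine ⟨A * ∑ i ∈ Finset.range (n + 1), B i, fun u k y => ?_⟩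
  rw [mul_assoc]
  refine hA ((hasCompactSupport_localSymbol D a u k).toSchwartzMap (contDiff_localSymbol D ha u k))
    _ (tsupport_localSymbol_subset_closedBall D a u k) (fun i hi v => (hB i u k v).trans ?_) y
  gcongr
  exact Finset.single_le_sum (fun i _ => hB0 i) (Finset.mem_range.2 (by omega))

/-- Transfer of a Fourier multiplier to convolution with its inverse Fourier transform. -/
lemma integral_mul_fourier_mul_exp {d : ℕ} {g h : RD d → ℂ} (hg : Integrable g)
    (hh : Integrable h) (x : RD d) :
    ∫ ξ, g ξ * 𝓕 h ξ * Complex.exp (2 * Real.pi * Complex.I * ((⟪x, ξ⟫ : ℝ) : ℂ))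
      = ∫ y, 𝓕 g (-y) * h (x - y) := by
  have hflip := VectorFourier.integral_fourierIntegral_smul_eq_flip (μ := volume) (ν := volume)
    (L := innerₗ (RD d)) (f := g) (g := h ∘ (· + x)) Real.continuous_fourierChar continuous_inner hg
    (hh.comp_add_right x)
  rw [flip_innerₗ, VectorFourier.fourierIntegral_comp_add_right] at hflip
  calc _ = ∫ ξ, g ξ • (fun w => Real.fourierChar (innerₗ (RD d) x w) •
        VectorFourier.fourierIntegral Real.fourierChar volume (innerₗ (RD d)) h w) ξ := by
        congr 1 with ξ
        simp only [Circle.smul_def, Real.fourierChar_apply, innerₗ_apply_apply, smul_eq_mul]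
        change g ξ * 𝓕 h ξ * _ = g ξ * (_ * 𝓕 h ξ)
        push_cast
        ring_nf
    _ = ∫ y, 𝓕 g y • (h ∘ (· + x)) y := hflip.symm
    _ = ∫ y, 𝓕 g (-y) • (h ∘ (· + x)) (-y) := (integral_neg_eq_self _ _).symm
    _ = _ := by
        congr 1 with y
        simp [sub_eq_neg_add]

lemma lintegral_ofReal_comp_smul {d : ℕ} {w : RD d → ℝ} (hw : Integrable w) (h0 : ∀ y, 0 ≤ w y)
    {t : ℝ} (ht : 0 < t) :
    ∫⁻ y, ENNReal.ofReal (t ^ d * w (t • y)) = ENNReal.ofReal (∫ y, w y) := by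
  rw [← ofReal_integral_eq_lintegral_ofReal ((hw.comp_smul ht.ne').const_mul _)
    (ae_of_all _ fun y => mul_nonneg (by positivity) (h0 _)), integral_const_mul,
    Measure.integral_comp_smul_of_nonneg _ _ _ (hR := ht.le), finrank_euclideanSpace_fin,
    smul_eq_mul, mul_inv_cancel_left₀ (by positivity)]

lemma enorm_le_peetre_mul {d : ℕ} {σ R : ℝ} (hR : 0 ≤ R) (g : RD d → ℂ) (x y : RD d) :
    ‖g (x - y)‖ₑ ≤ peetre σ R g x * ENNReal.ofReal ((1 + R * ‖y‖) ^ σ) := by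
  have hpos : 0 < (1 + R * ‖y‖) ^ σ := by positivity
  rw [← ENNReal.div_le_iff (by simpa using hpos) ENNReal.ofReal_ne_top]
  exact le_iSup (fun y => (‖g (x - y)‖₊ : ℝ≥0∞) / ENNReal.ofReal ((1 + R * ‖y‖) ^ σ)) y

/-- The pointwise bound for the symbol frozen at a base point `u`, uniformly in `u`. -/
lemma exists_frozen_symbol_bound {d : ℕ} (D : LPData d) {m : ℝ} {a : RD d → RD d → ℂ}
    (ha : IsSymbolS11 d m a) (σ : ℝ) :
    ∃ C : ℝ≥0, ∀ k : ℕ, 2 ≤ k → ∀ (u x : RD d) (f : 𝓢(RD d, ℂ)),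
      ‖∫ ξ, a u ξ * LPhat D k ξ * fourierS f ξ *
          Complex.exp (2 * Real.pi * Complex.I * ((⟪x, ξ⟫ : ℝ) : ℂ))‖ₑ ≤
        (C : ℝ≥0∞) * (2 : ℝ≥0∞) ^ ((k : ℝ) * m) * peetre σ ((2 : ℝ) ^ k) (LPstar D k (⇑f)) x := by
  set n : ℕ := ⌈σ⌉₊ + (d + 1) with hn
  obtain ⟨A, hA⟩ := exists_fourier_localSymbol_decay D ha n
  set w : RD d → ℝ := fun y => (1 + ‖y‖) ^ (-((d : ℝ) + 1)) with hw
  have hw0 : ∀ y, 0 ≤ w y := fun y => by positivity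
  have hwint : Integrable w := integrable_one_add_norm (by simp)
  have hdecay : ∀ (u : RD d) (k : ℕ) (y : RD d),
      ‖𝓕 (localSymbol D a u k) y‖ * (1 + ‖y‖) ^ σ ≤ |A| * (2 : ℝ) ^ ((k : ℝ) * m) * w y := by
    intro u k y
    have h1 : 1 ≤ 1 + ‖y‖ := by linarith [norm_nonneg y]
    have hσ : (1 + ‖y‖) ^ σ ≤ (1 + ‖y‖) ^ n * w y := by
      rw [hw, ← Real.rpow_natCast, ← Real.rpow_add (by positivity)]
      refine Real.rpow_le_rpow_of_exponent_le h1 ?_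
      rw [hn]
      push_cast
      linarith [Nat.le_ceil σ]
    calc _ ≤ ‖𝓕 (localSymbol D a u k) y‖ * ((1 + ‖y‖) ^ n * w y) := by gcongr
      _ = (1 + ‖y‖) ^ n * ‖𝓕 (localSymbol D a u k) y‖ * w y := by ring
      _ ≤ |A| * (2 : ℝ) ^ ((k : ℝ) * m) * w y := by
          refine mul_le_mul_of_nonneg_right ((hA u k y).trans ?_) (hw0 y)
          gcongr
          exact le_abs_self A
  refine ⟨(|A| * ∫ y, w y).toNNReal, fun k hk u x f => ?_⟩
  obtain ⟨h, hh, hhat⟩ := exists_schwartz_LPstar D (k := k) (by omega) f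
  set t : ℝ := 2 ^ k with ht
  have ht0 : 0 < t := by positivity
  have hfac : ∀ ξ, a u ξ * LPhat D k ξ = localSymbol D a u k (t⁻¹ • ξ) := by
    intro ξ
    obtain ⟨i, rfl⟩ := Nat.exists_eq_succ_of_ne_zero (show k ≠ 0 by omega)
    rw [localSymbol, ← ht, smul_inv_smul₀ ht0.ne', LPhat, ht]
  have hmul : ∀ ξ, a u ξ * LPhat D k ξ * fourierS f ξ
      = localSymbol D a u k (t⁻¹ • ξ) * 𝓕 (⇑h) ξ := by
    intro ξ
    rw [← hfac, ← SchwartzMap.fourier_coe, hhat, fourierS_eq]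
    by_cases h0 : LPhat D k ξ = 0
    · simp [h0]
    · rw [LPhat_star_eq_one D hk h0, one_mul]
  have hgint : Integrable fun ξ => localSymbol D a u k (t⁻¹ • ξ) :=
    ((contDiff_localSymbol D ha u k).continuous.integrable_of_hasCompactSupport
      (hasCompactSupport_localSymbol D a u k)).comp_smul (inv_ne_zero ht0.ne')
  simp_rw [hmul]
  rw [integral_mul_fourier_mul_exp hgint h.integrable x]
  set P := peetre σ t (LPstar D k ⇑f) x
  calc _ ≤ ∫⁻ y, ‖𝓕 (fun ξ => localSymbol D a u k (t⁻¹ • ξ)) (-y) * h (x - y)‖ₑ :=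
        enorm_integral_le_lintegral_enorm _
    _ ≤ ∫⁻ y, ENNReal.ofReal (|A| * (2 : ℝ) ^ ((k : ℝ) * m)) * P *
          ENNReal.ofReal (t ^ d * w (t • y)) := by
        refine lintegral_mono fun y => ?_
        have hy : ‖𝓕 (fun ξ => localSymbol D a u k (t⁻¹ • ξ)) (-y)‖ * (1 + t * ‖y‖) ^ σ
            ≤ |A| * (2 : ℝ) ^ ((k : ℝ) * m) * (t ^ d * w (t • y)) := by
          have hd := hdecay u k (t • -y)
          have hw' : w (t • -y) = w (t • y) := by simp [hw]
          rw [hw', norm_smul, norm_neg, Real.norm_of_nonneg ht0.le] at hd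
          rw [fourier_comp_smul _ (inv_pos.2 ht0), inv_inv, inv_pow, inv_inv, norm_mul,
            Complex.norm_real, Real.norm_of_nonneg (by positivity)]
          calc _ = t ^ d * (‖𝓕 (localSymbol D a u k) (t • -y)‖ * (1 + t * ‖y‖) ^ σ) := by ring
            _ ≤ t ^ d * (|A| * (2 : ℝ) ^ ((k : ℝ) * m) * w (t • y)) := by gcongr
            _ = _ := by ring
        rw [enorm_mul, hh]
        calc _ ≤ ‖𝓕 (fun ξ => localSymbol D a u k (t⁻¹ • ξ)) (-y)‖ₑ *
              (P * ENNReal.ofReal ((1 + t * ‖y‖) ^ σ)) := by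
              gcongr
              exact enorm_le_peetre_mul ht0.le _ x y
          _ = P * ENNReal.ofReal (‖𝓕 (fun ξ => localSymbol D a u k (t⁻¹ • ξ)) (-y)‖ *
              (1 + t * ‖y‖) ^ σ) := by
              rw [ENNReal.ofReal_mul (norm_nonneg _), ofReal_norm]; ring
          _ ≤ P * ENNReal.ofReal (|A| * (2 : ℝ) ^ ((k : ℝ) * m) * (t ^ d * w (t • y))) := by
              gcongr
          _ = _ := by
              rw [ENNReal.ofReal_mul (by positivity)]; ring
    _ = ENNReal.ofReal (|A| * (2 : ℝ) ^ ((k : ℝ) * m)) * P * ENNReal.ofReal (∫ y, w y) := by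
        rw [lintegral_const_mul'' _
            ((hwint.comp_smul ht0.ne').const_mul _).aemeasurable.ennreal_ofReal,
          lintegral_ofReal_comp_smul hwint hw0 ht0]
    _ = _ := by
        change _ = ENNReal.ofReal (|A| * ∫ y, w y) * _ * _
        rw [ENNReal.ofReal_mul (abs_nonneg A), ENNReal.ofReal_mul (abs_nonneg A),
          ← ENNReal.ofReal_rpow_of_pos two_pos, ENNReal.ofReal_ofNat]
        ring

lemma continuous_LPhat {d : ℕ} (D : LPData d) (k : ℕ) : Continuous (LPhat D k) := by
  obtain ⟨κ, -, h⟩ := exists_schwartz_LPkernel D k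
  exact h ▸ (fourierS κ).continuous

lemma hasCompactSupport_LPhat {d : ℕ} (D : LPData d) {k : ℕ} (hk : k ≠ 0) :
    HasCompactSupport (LPhat D k) := by
  obtain ⟨i, rfl⟩ := Nat.exists_eq_succ_of_ne_zero hk
  refine HasCompactSupport.intro (isCompact_closedBall 0 (2 ^ (i + 1) * 2)) fun ξ hξ => ?_
  by_contra h
  have := (D.supp_φ _ h).2
  rw [norm_smul, norm_inv, norm_pow, Real.norm_two, inv_mul_le_iff₀ (by positivity)] at this
  exact hξ (by simpa using this)

/-- The sum of the pieces of the symbol is a single average of translates of the symbol. -/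
lemma bsym_eq {d : ℕ} (D : LPData d) {m : ℝ} {a : RD d → RD d → ℂ} (ha : IsSymbolS11 d m a)
    (n : ℕ) (x ξ : RD d) :
    bsym D a (n + 3) x ξ =
      (∫ z, (((2 : ℝ) ^ (n * d) : ℝ) : ℂ) * D.Φ ((2 : ℝ) ^ n • z) * a (x - z) ξ) *
        LPhat D (n + 3) ξ := by
  obtain ⟨c, -, hc⟩ := ha.norm_iteratedFDeriv_le 0
  have hint : ∀ j, Integrable fun z => LPkernel D j z * a (x - z) ξ := by
    intro j
    obtain ⟨κ, hκ, -⟩ := exists_schwartz_LPkernel D j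
    rw [← hκ]
    refine κ.integrable.mul_bdd (c := c * (1 + ‖ξ‖) ^ (m - (0 : ℕ))) ?_ (ae_of_all _ fun z => ?_)
    · have := ha.1.continuous
      exact (this.comp (f := fun z => (x - z, ξ)) (by fun_prop)).aestronglyMeasurable
    · simpa using hc (x - z) ξ
  simp only [bsym, symbolPiece]
  rw [← Finset.sum_mul, ← integral_finsetSum _ fun j _ => hint j]
  simp only [← Finset.sum_mul]
  congr 3 with z
  rw [← sum_LPkernel]
  rfl

lemma pdo_bsym_eq {d : ℕ} (D : LPData d) {m : ℝ} {a : RD d → RD d → ℂ} (ha : IsSymbolS11 d m a)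
    (n : ℕ) (f : 𝓢(RD d, ℂ)) (x : RD d) :
    pdo (bsym D a (n + 3)) f x =
      ∫ z, (((2 : ℝ) ^ (n * d) : ℝ) : ℂ) * D.Φ ((2 : ℝ) ^ n • z) *
        ∫ ξ, a (x - z) ξ * LPhat D (n + 3) ξ * fourierS f ξ *
          Complex.exp (2 * Real.pi * Complex.I * ((⟪x, ξ⟫ : ℝ) : ℂ)) := by
  obtain ⟨c, -, hc⟩ := ha.norm_iteratedFDeriv_le 0
  set Ψ : RD d → ℂ := fun z => (((2 : ℝ) ^ (n * d) : ℝ) : ℂ) * D.Φ ((2 : ℝ) ^ n • z) with hΨ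
  set e : RD d → ℂ := fun ξ => Complex.exp (2 * Real.pi * Complex.I * ((⟪x, ξ⟫ : ℝ) : ℂ)) with he
  have hec : Continuous e := by fun_prop
  have hΨc : Continuous Ψ := continuous_const.mul (D.Φ.continuous.comp (continuous_const_smul _))
  have hΨi : Integrable Ψ := (D.Φ.integrable.comp_smul (by positivity)).const_mul _
  have hLc := continuous_LPhat D (n + 3)
  have hfc := (fourierS f).continuous
  have hac := ha.1.continuous
  set b : RD d → ℝ := fun ξ =>
    (c * (1 + ‖ξ‖) ^ (m - (0 : ℕ))) * ‖fourierS f ξ‖ * ‖LPhat D (n + 3) ξ‖ with hb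
  have hbi : Integrable b := by
    refine Continuous.integrable_of_hasCompactSupport ?_
      (hasCompactSupport_LPhat D (Nat.succ_ne_zero _)).norm.mul_left
    refine ((continuous_const.mul (Continuous.rpow_const (by fun_prop) fun ξ => Or.inl ?_)).mul
      hfc.norm).mul hLc.norm
    positivity
  have hnorm : ∀ ξ, ‖e ξ‖ = 1 := fun ξ => by
    have : e ξ = Complex.exp (((2 * Real.pi * ⟪x, ξ⟫ : ℝ) : ℂ) * Complex.I) := by
      simp only [he]; push_cast; ring_nf
    rw [this, Complex.norm_exp_ofReal_mul_I]
  have hprod : Integrable (Function.uncurry fun ξ z =>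
      Ψ z * (a (x - z) ξ * LPhat D (n + 3) ξ * fourierS f ξ * e ξ))
      ((volume : Measure (RD d)).prod (volume : Measure (RD d))) := by
    refine (hbi.mul_prod hΨi.norm).mono' ?_ (ae_of_all _ fun p => ?_)
    · refine Continuous.aestronglyMeasurable ?_
      have h1 : Continuous fun p : RD d × RD d => a (x - p.2) p.1 :=
        hac.comp (f := fun p : RD d × RD d => (x - p.2, p.1)) (by fun_prop)
      exact (hΨc.comp continuous_snd).mul (((h1.mul (hLc.comp continuous_fst)).mul
        (hfc.comp continuous_fst)).mul (hec.comp continuous_fst))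
    · have := hc (x - p.2) p.1
      rw [norm_iteratedFDeriv_zero] at this
      simp only [Function.uncurry, norm_mul, hnorm, mul_one, hb]
      calc _ = ‖a (x - p.2) p.1‖ * (‖fourierS f p.1‖ * ‖LPhat D (n + 3) p.1‖ * ‖Ψ p.2‖) := by ring
        _ ≤ (c * (1 + ‖p.1‖) ^ (m - (0 : ℕ))) *
            (‖fourierS f p.1‖ * ‖LPhat D (n + 3) p.1‖ * ‖Ψ p.2‖) := by gcongr
        _ = _ := by ring
  calc pdo (bsym D a (n + 3)) f x
      = ∫ ξ, ∫ z, Ψ z * (a (x - z) ξ * LPhat D (n + 3) ξ * fourierS f ξ * e ξ) := by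
        rw [pdo]
        congr 1 with ξ
        rw [bsym_eq D ha, ← integral_mul_const, ← integral_mul_const, ← integral_mul_const]
        congr 1 with z
        simp only [hΨ, he]
        ring
    _ = ∫ z, ∫ ξ, Ψ z * (a (x - z) ξ * LPhat D (n + 3) ξ * fourierS f ξ * e ξ) :=
        integral_integral_swap hprod
    _ = _ := by simp_rw [integral_const_mul]; rfl

/-- the pointwise bound `|T_{b_k} f(x)| ≲ 2^{km} 𝔐_{σ,2^k}(Π*_k f)(x)`,
uniformly in `k ≥ 3`, `x` and `f`. -/
theorem statement12 (d : ℕ) (hd : 1 ≤ d) (m : ℝ)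
    (D : LPData d) (a : RD d → RD d → ℂ) (ha : IsSymbolS11 d m a)
    (σ : ℝ) (hσ : 0 < σ) :
    ∃ C : ℝ≥0, ∀ k : ℕ, 3 ≤ k → ∀ (x : RD d) (f : 𝓢(RD d, ℂ)),
      (‖pdo (bsym D a k) f x‖₊ : ℝ≥0∞) ≤
        (C : ℝ≥0∞) * (2:ℝ≥0∞)^((k:ℝ)*m) * peetre σ ((2:ℝ)^k) (LPstar D k (⇑f)) x := by

  obtain ⟨C, hC⟩ := exists_frozen_symbol_bound D ha σ
  refine ⟨(∫ y, ‖D.Φ y‖).toNNReal * C, fun k hk x f => ?_⟩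
  obtain ⟨n, rfl⟩ := Nat.exists_eq_add_of_le' hk
  have ht : (0 : ℝ) < 2 ^ n := by positivity
  have hΦ : ∀ z : RD d, ‖(((2 : ℝ) ^ (n * d) : ℝ) : ℂ) * D.Φ ((2 : ℝ) ^ n • z)‖ₑ
      = ENNReal.ofReal (((2 : ℝ) ^ n) ^ d * ‖D.Φ ((2 : ℝ) ^ n • z)‖) := fun z => by
    rw [← ofReal_norm, norm_mul, Complex.norm_real, Real.norm_of_nonneg (by positivity), pow_mul]
  rw [pdo_bsym_eq D ha]
  refine (enorm_integral_le_lintegral_enorm _).trans ?_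
  calc _ ≤ ∫⁻ z, ENNReal.ofReal (((2 : ℝ) ^ n) ^ d * ‖D.Φ ((2 : ℝ) ^ n • z)‖) *
        ((C : ℝ≥0∞) * (2 : ℝ≥0∞) ^ (((n + 3 : ℕ) : ℝ) * m) *
          peetre σ ((2 : ℝ) ^ (n + 3)) (LPstar D (n + 3) (⇑f)) x) := by
        refine lintegral_mono fun z => ?_
        rw [enorm_mul, hΦ]
        gcongr
        exact hC (n + 3) (by omega) (x - z) x f
    _ = _ := by
        rw [lintegral_mul_const'' _ ((D.Φ.integrable.norm.comp_smul ht.ne').const_mul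
            _).aemeasurable.ennreal_ofReal,
          lintegral_ofReal_comp_smul D.Φ.integrable.norm (fun y => norm_nonneg _) ht,
          ENNReal.coe_mul]
        simp only [ENNReal.ofReal, mul_assoc]

end
end

section
/- Let d ≥ 1, m ∈ ℝ, and a ∈ S^m_{1,1}. For j,k ≥ 0 define the kernel W_{j,k}(x,y) := ∫_{ℝ^d} a_{j,k}(x,ξ) e^{2πi⟨x−y,ξ⟩} dξ (an absolutely convergent integral, since a_{j,k}(x,·) is compactly supported). Then for every N > 0 and M > 0 there is a constant C, independent of j, k, x, y, such that for all integers j ≥ 3 and 0 ≤ k ≤ j − 3 and all x, y ∈ ℝ^d: |W_{j,k}(x,y)| ≤ C · 2^{k(m+d)} · 2^{−(j−k)N} · (1 + 2^k|x−y|)^{−M}. -/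
noncomputable section

open MeasureTheory SchwartzMap Complex RealInnerProductSpace Filter
open scoped ENNReal NNReal ContDiff SchwartzMap

/-- The kernel `W_{j,k}(x,y) = ∫ a_{j,k}(x,ξ) e^{2πi⟨x-y,ξ⟩} dξ` of `T_{a_{j,k}}`. -/
def Wkernel {d : ℕ} (D : LPData d) (a : RD d → RD d → ℂ) (j k : ℕ) (x y : RD d) : ℂ :=
  ∫ ξ, symbolPiece D a j k x ξ * Complex.exp (2 * Real.pi * Complex.I * ((⟪x - y, ξ⟫ : ℝ) : ℂ))


section Taylor

variable {E : Type*} [NormedAddCommGroup E] [NormedSpace ℝ E]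

/-- The iterated derivatives of a smooth function along a line. -/
lemma iteratedDeriv_comp_add_smul {g : E → ℂ} {n : ℕ} (hg : ContDiff ℝ n g) (x v : E) (t : ℝ) :
    iteratedDeriv n (fun t : ℝ => g (x + t • v)) t
      = iteratedFDeriv ℝ n g (x + t • v) (fun _ => v) := by
  have hshift : ContDiff ℝ n (fun z => g (x + z)) := hg.comp (contDiff_const.add contDiff_id)
  have h := (ContinuousLinearMap.toSpanSingleton ℝ v).iteratedFDeriv_comp_right hshift t le_rfl
  rw [iteratedDeriv_eq_iteratedFDeriv]
  change iteratedFDeriv ℝ n ((fun z => g (x + z)) ∘ ContinuousLinearMap.toSpanSingleton ℝ v) t _ = _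
  rw [h, iteratedFDeriv_comp_add_left]
  simp

/-- Taylor's formula with integral remainder for functions of several variables. -/
lemma taylor_integral_remainder_line {g : E → ℂ} {n : ℕ} (hg : ContDiff ℝ (n + 1 : ℕ) g)
    (x v : E) :
    g (x + v) = ∑ i ∈ Finset.range (n + 1),
        ((i.factorial : ℝ)⁻¹) • iteratedFDeriv ℝ i g x (fun _ => v)
      + ∫ t in Set.Icc (0 : ℝ) 1, ((1 - t) ^ n / n.factorial) •
          iteratedFDeriv ℝ (n + 1) g (x + t • v) (fun _ => v) := by
  have hline : ContDiff ℝ (n + 1 : ℕ) (fun t : ℝ => g (x + t • v)) := by fun_prop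
  have hderiv : ∀ i ≤ n + 1, ∀ t ∈ Set.uIcc (0 : ℝ) 1,
      iteratedDerivWithin i (fun t : ℝ => g (x + t • v)) (Set.uIcc 0 1) t
        = iteratedFDeriv ℝ i g (x + t • v) (fun _ => v) := by
    intro i hi t ht
    rw [iteratedDerivWithin_eq_iteratedDeriv (uniqueDiffOn_uIcc zero_ne_one)
      ((hline.of_le (mod_cast hi)).contDiffAt) ht]
    exact iteratedDeriv_comp_add_smul (hg.of_le (mod_cast hi)) x v t
  have h := taylor_integral_remainder (x := (1 : ℝ)) (x₀ := 0) hline.contDiffOn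
  rw [taylor_within_apply, sub_eq_iff_eq_add'] at h
  simp only [one_smul] at h
  rw [h]
  congr 1
  · refine Finset.sum_congr rfl fun i hi => ?_
    rw [hderiv i (Finset.mem_range.1 hi).le 0 (by simp)]
    simp
  · rw [integral_Icc_eq_integral_Ioc, ← intervalIntegral.integral_of_le zero_le_one]
    exact intervalIntegral.integral_congr fun t ht => by
      simp only [hderiv (n + 1) le_rfl t ht]

end Taylor

section Moments

variable {d : ℕ}

/-- A Schwartz function whose Fourier transform vanishes near the origin has vanishing moments. -/
lemma integral_mul_multilinear_eq_zero (f : 𝓢(RD d, ℂ))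
    (hf : ∀ᶠ ξ in nhds (0 : RD d), fourierS f ξ = 0) (n : ℕ)
    (P : ContinuousMultilinearMap ℝ (fun _ : Fin n => RD d) ℂ) :
    ∫ y, f y * P (fun _ => y) = 0 := by
  have hint : Integrable (fun v => VectorFourier.fourierPowSMulRight (innerSL ℝ) f v n) :=
    VectorFourier.integrable_fourierPowSMulRight _ (f.integrable_pow_mul volume n)
      f.continuous.aestronglyMeasurable
  have hzero : ∫ v, VectorFourier.fourierPowSMulRight (innerSL ℝ) f v n = 0 := by
    have h := Real.iteratedFDeriv_fourier (f := (f : RD d → ℂ)) (N := ⊤)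
      (fun n _ => f.integrable_pow_mul volume n) f.continuous.aestronglyMeasurable
      (n := n) le_top
    have h0 : iteratedFDeriv ℝ n (FourierTransform.fourier (f : RD d → ℂ)) 0 = 0 := by
      have he : FourierTransform.fourier (f : RD d → ℂ) =ᶠ[nhds 0] fun _ => (0 : ℂ) := by
        filter_upwards [hf] with ξ hξ
        exact hξ
      rw [(he.iteratedFDeriv ℝ n).eq_of_nhds]
      simp
    rw [h, Real.fourier_eq] at h0
    simpa using h0
  have hmon : ∀ r : Fin n → Fin d, ∫ y : RD d, (∏ i, (y (r i) : ℝ)) • f y = 0 := by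
    intro r
    have h := congrArg (fun T => T (fun i => EuclideanSpace.single (r i) (1 : ℝ))) hzero
    simp only [ContinuousMultilinearMap.integral_apply hint,
      VectorFourier.fourierPowSMulRight_apply, integral_smul] at h
    have hcoord : ∀ (y : RD d) (i : Fin n),
        innerSL ℝ y (EuclideanSpace.single (r i) (1 : ℝ)) = y (r i) := by
      intro y i
      change ⟪y, EuclideanSpace.single (r i) (1 : ℝ)⟫ = y (r i)
      simp [EuclideanSpace.inner_single_right]
    simp only [hcoord] at h
    simpa [Real.pi_ne_zero, Complex.I_ne_zero] using h
  have hmon_int : ∀ r : Fin n → Fin d, Integrable fun y : RD d => (∏ i, (y (r i) : ℝ)) • f y := by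
    intro r
    refine (f.integrable_pow_mul volume n).mono' (by fun_prop) (ae_of_all _ fun y => ?_)
    rw [norm_smul, norm_prod]
    gcongr
    calc ∏ i, ‖y (r i)‖ ≤ ∏ _i : Fin n, ‖y‖ :=
          Finset.prod_le_prod (fun _ _ => norm_nonneg _) fun i _ => PiLp.norm_apply_le y (r i)
      _ = ‖y‖ ^ n := by simp
  have hexpand : ∀ y : RD d, f y * P (fun _ => y) = ∑ r : Fin n → Fin d,
      ((∏ i, (y (r i) : ℝ)) • f y) * P (fun i => EuclideanSpace.single (r i) (1 : ℝ)) := by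
    intro y
    have hy : y = ∑ i, y i • EuclideanSpace.single i (1 : ℝ) := by
      have := (EuclideanSpace.basisFun (Fin d) ℝ).sum_repr y
      simpa using this.symm
    conv_lhs => rw [show (fun _ : Fin n => y) = fun _ : Fin n =>
      ∑ i, y i • EuclideanSpace.single i (1 : ℝ) from funext fun _ => hy]
    rw [P.map_sum, Finset.mul_sum]
    refine Finset.sum_congr rfl fun r _ => ?_
    rw [P.map_smul_univ]
    simp only [Complex.real_smul]
    ring
  simp_rw [hexpand]
  rw [integral_finsetSum _ fun r _ => (hmon_int r).mul_const _]
  simp only [integral_mul_const, hmon, zero_mul, Finset.sum_const_zero]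

end Moments

section TaylorMoments

variable {d : ℕ}

/-- The weight `f(y) (1-t)^n / n!` appearing in Taylor's formula with integral remainder. -/
def taylorWeight (f : 𝓢(RD d, ℂ)) (n : ℕ) (p : RD d × ℝ) : ℂ :=
  f p.1 * (((1 - p.2) ^ n / n.factorial : ℝ) : ℂ)

/-- Lebesgue measure on `ℝ^d × [0,1]`. -/
def cylinderMeasure (d : ℕ) : Measure (RD d × ℝ) :=
  (volume : Measure (RD d)).prod (volume.restrict (Set.Icc (0 : ℝ) 1))

instance : SFinite (cylinderMeasure d) := by
  unfold cylinderMeasure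
  infer_instance

lemma continuous_taylorWeight (f : 𝓢(RD d, ℂ)) (n : ℕ) : Continuous (taylorWeight f n) := by
  unfold taylorWeight
  have := f.continuous
  fun_prop

lemma ae_cylinderMeasure_mem : ∀ᵐ p ∂(cylinderMeasure d), p.2 ∈ Set.Icc (0 : ℝ) 1 :=
  Measure.quasiMeasurePreserving_snd.ae (ae_restrict_mem measurableSet_Icc)

lemma norm_taylorWeight_le (f : 𝓢(RD d, ℂ)) (n : ℕ) {p : RD d × ℝ}
    (hp : p.2 ∈ Set.Icc (0 : ℝ) 1) : ‖taylorWeight f n p‖ ≤ ‖f p.1‖ := by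
  have h1 : 0 ≤ 1 - p.2 := by linarith [hp.2]
  have h2 : 1 - p.2 ≤ 1 := by linarith [hp.1]
  have h3 : (1 - p.2) ^ n / (n.factorial : ℝ) ≤ 1 :=
    div_le_one_of_le₀ ((pow_le_one₀ h1 h2).trans (mod_cast n.factorial_pos)) (by positivity)
  rw [taylorWeight, norm_mul, Complex.norm_real, Real.norm_of_nonneg (by positivity)]
  exact mul_le_of_le_one_right (norm_nonneg _) h3

lemma integrable_norm_pow_mul_cylinder (f : 𝓢(RD d, ℂ)) (k : ℕ) :
    Integrable (fun p : RD d × ℝ => ‖p.1‖ ^ k * ‖f p.1‖) (cylinderMeasure d) := by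
  have h := (f.integrable_pow_mul volume k).mul_prod
    (integrable_const (1 : ℝ) : Integrable _ (volume.restrict (Set.Icc (0 : ℝ) 1)))
  simpa [cylinderMeasure] using h

/-- Averaging a smooth function against a Schwartz function with vanishing moments only sees
the Taylor remainder. -/
lemma integral_schwartz_mul_comp_sub_smul (f : 𝓢(RD d, ℂ))
    (hf : ∀ᶠ ξ in nhds (0 : RD d), fourierS f ξ = 0) {g : RD d → ℂ} {n : ℕ}
    (hg : ContDiff ℝ (n + 1 : ℕ) g) {B : ℝ} (hB : ∀ u, ‖iteratedFDeriv ℝ (n + 1) g u‖ ≤ B)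
    (x : RD d) (s : ℝ) :
    ∫ y, f y * g (x - s • y) = (((-s) ^ (n + 1) : ℝ) : ℂ) *
      ∫ p, taylorWeight f n p *
        iteratedFDeriv ℝ (n + 1) g (x - (p.2 * s) • p.1) (fun _ => p.1) ∂(cylinderMeasure d) := by
  have hcont : Continuous (iteratedFDeriv ℝ (n + 1) g) := hg.continuous_iteratedFDeriv le_rfl
  have hrem : Integrable (fun p : RD d × ℝ => taylorWeight f n p *
      iteratedFDeriv ℝ (n + 1) g (x - (p.2 * s) • p.1) (fun _ => p.1)) (cylinderMeasure d) := by
    refine ((integrable_norm_pow_mul_cylinder f (n + 1)).mul_const B).mono' ?_ ?_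
    · have := continuous_taylorWeight f n
      exact (this.mul (Continuous.eval (by fun_prop) (by fun_prop))).aestronglyMeasurable
    · filter_upwards [ae_cylinderMeasure_mem] with p hp
      rw [norm_mul]
      have h1 : ‖iteratedFDeriv ℝ (n + 1) g (x - (p.2 * s) • p.1) (fun _ => p.1)‖
          ≤ B * ‖p.1‖ ^ (n + 1) := by
        refine (ContinuousMultilinearMap.le_opNorm _ _).trans ?_
        simp only [Finset.prod_const, Finset.card_univ, Fintype.card_fin]
        gcongr
        exact hB _
      calc _ ≤ ‖f p.1‖ * (B * ‖p.1‖ ^ (n + 1)) :=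
            mul_le_mul (norm_taylorWeight_le f n hp) h1 (norm_nonneg _) (norm_nonneg _)
        _ = _ := by ring
  have hpoint : ∀ y, f y * g (x - s • y) =
      (∑ i ∈ Finset.range (n + 1), (((i.factorial : ℝ)⁻¹ * (-s) ^ i : ℝ) : ℂ) *
        (f y * iteratedFDeriv ℝ i g x (fun _ => y))) +
      (((-s) ^ (n + 1) : ℝ) : ℂ) * ∫ t in Set.Icc (0 : ℝ) 1, taylorWeight f n (y, t) *
        iteratedFDeriv ℝ (n + 1) g (x - (t * s) • y) (fun _ => y) := by
    intro y
    have hv : x - s • y = x + (-s) • y := by rw [neg_smul, sub_eq_add_neg]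
    rw [hv, taylor_integral_remainder_line hg x ((-s) • y), mul_add, Finset.mul_sum]
    congr 1
    · refine Finset.sum_congr rfl fun i _ => ?_
      rw [(iteratedFDeriv ℝ i g x).map_smul_univ (fun _ => -s) (fun _ => y)]
      simp only [Complex.real_smul, Finset.prod_const, Finset.card_univ, Fintype.card_fin]
      push_cast
      ring
    · rw [← integral_const_mul, ← integral_const_mul]
      refine integral_congr_ae (ae_of_all _ fun t => ?_)
      have hu : x + t • (-s) • y = x - (t * s) • y := by
        rw [neg_smul, smul_neg, smul_smul, sub_eq_add_neg]
      simp only [hu]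
      rw [(iteratedFDeriv ℝ (n + 1) g _).map_smul_univ (fun _ => -s) (fun _ => y)]
      simp only [Complex.real_smul, Finset.prod_const, Finset.card_univ, Fintype.card_fin,
        taylorWeight]
      push_cast
      ring
  have hpoly_int : ∀ i, Integrable fun y => f y * iteratedFDeriv ℝ i g x (fun _ => y) := by
    intro i
    refine ((f.integrable_pow_mul volume i).mul_const ‖iteratedFDeriv ℝ i g x‖).mono' ?_ ?_
    · have := f.continuous
      exact (this.mul (Continuous.eval (by fun_prop) (by fun_prop))).aestronglyMeasurable
    · refine ae_of_all _ fun y => ?_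
      have h1 := (iteratedFDeriv ℝ i g x).le_opNorm (fun _ => y)
      simp only [Finset.prod_const, Finset.card_univ, Fintype.card_fin] at h1
      rw [norm_mul]
      calc _ ≤ ‖f y‖ * (‖iteratedFDeriv ℝ i g x‖ * ‖y‖ ^ i) := by gcongr
        _ = _ := by ring
  simp_rw [hpoint]
  rw [integral_add, integral_finsetSum]
  · simp only [integral_const_mul, integral_mul_multilinear_eq_zero f hf, mul_zero,
      Finset.sum_const_zero, zero_add]
    rw [cylinderMeasure, integral_prod _ hrem]
  · exact fun i _ => (hpoly_int i).const_mul _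
  · exact integrable_finsetSum _ fun i _ => (hpoly_int i).const_mul _
  · exact hrem.integral_prod_left.const_mul _

end TaylorMoments

section FourierDecay

variable {d : ℕ} {V : Type*} [NormedAddCommGroup V] [NormedSpace ℂ V]

/-- Derivative bounds for the product of a Schwartz function and a function with derivatives of
polynomial growth. -/
lemma exists_norm_iteratedFDeriv_schwartz_smul_le (ψ : 𝓢(RD d, ℂ)) (L K : ℕ) :
    ∃ C : ℝ, 0 ≤ C ∧ ∀ (h : RD d → V) (B : ℝ), 0 ≤ B → ContDiff ℝ ∞ h →
      (∀ i ≤ L, ∀ η ∈ tsupport ψ, ‖iteratedFDeriv ℝ i h η‖ ≤ B * (1 + ‖η‖) ^ K) →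
      ∀ p ≤ L, ∀ η, ‖iteratedFDeriv ℝ p (fun η => ψ η • h η) η‖
        ≤ C * B * (1 + ‖η‖) ^ (-((d : ℝ) + 1)) := by
  set S : ℝ := 2 ^ (K + d + 1) *
    (Finset.Iic (K + d + 1, L)).sup (fun m => SchwartzMap.seminorm ℝ m.1 m.2) ψ with hSdef
  have hS : ∀ i ≤ L, ∀ η, (1 + ‖η‖) ^ (K + d + 1) * ‖iteratedFDeriv ℝ i ψ η‖ ≤ S :=
    fun i hi η => SchwartzMap.one_add_le_sup_seminorm_apply (m := (K + d + 1, L)) le_rfl hi ψ η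
  have hS0 : 0 ≤ S := le_trans (by positivity) (hS 0 (Nat.zero_le _) 0)
  refine ⟨2 ^ L * S, by positivity, fun h B hB0 hh hB p hp η => ?_⟩
  have hpos : 0 < 1 + ‖η‖ := by positivity
  have hrw : (1 + ‖η‖) ^ (-((d : ℝ) + 1)) = ((1 + ‖η‖) ^ (d + 1))⁻¹ := by
    rw [Real.rpow_neg hpos.le, ← Real.rpow_natCast]
    push_cast
    rfl
  rw [hrw]
  by_cases hη : η ∈ tsupport ψ
  · refine (norm_iteratedFDeriv_smul_le (N := ∞) (ψ.smooth ⊤) hh η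
      (by exact_mod_cast le_top)).trans ?_
    calc ∑ i ∈ Finset.range (p + 1), (p.choose i : ℝ) * ‖iteratedFDeriv ℝ i ψ η‖ *
          ‖iteratedFDeriv ℝ (p - i) h η‖
        ≤ ∑ i ∈ Finset.range (p + 1), (p.choose i : ℝ) * (S * B * ((1 + ‖η‖) ^ (d + 1))⁻¹) := by
          refine Finset.sum_le_sum fun i hi => ?_
          have hiL : i ≤ L := by have := Finset.mem_range.1 hi; omega
          rw [mul_assoc]
          refine mul_le_mul_of_nonneg_left ?_ (Nat.cast_nonneg _)
          have h1 := hS i hiL η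
          have h2 := hB (p - i) (by omega) η hη
          calc ‖iteratedFDeriv ℝ i ψ η‖ * ‖iteratedFDeriv ℝ (p - i) h η‖
              ≤ ‖iteratedFDeriv ℝ i ψ η‖ * (B * (1 + ‖η‖) ^ K) := by gcongr
            _ = ((1 + ‖η‖) ^ (K + d + 1) * ‖iteratedFDeriv ℝ i ψ η‖) * B *
                  ((1 + ‖η‖) ^ (d + 1))⁻¹ := by
                field_simp
                ring
            _ ≤ S * B * ((1 + ‖η‖) ^ (d + 1))⁻¹ := by gcongr
      _ = 2 ^ p * (S * B * ((1 + ‖η‖) ^ (d + 1))⁻¹) := by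
          rw [← Finset.sum_mul]
          congr 1
          exact_mod_cast Nat.sum_range_choose p
      _ ≤ 2 ^ L * (S * B * ((1 + ‖η‖) ^ (d + 1))⁻¹) := by
          gcongr
          norm_num
      _ = _ := by ring
  · have hz : (fun η => ψ η • h η) =ᶠ[nhds η] fun _ => (0 : V) := by
      filter_upwards [(notMem_tsupport_iff_eventuallyEq).1 hη] with ζ hζ
      rw [hζ, Pi.zero_apply, zero_smul]
    rw [(hz.iteratedFDeriv ℝ p).eq_of_nhds]
    simp only [iteratedFDeriv_fun_zero, Pi.zero_apply, norm_zero]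
    positivity

lemma integrable_one_add_norm_rpow_neg :
    Integrable (fun η : RD d => (1 + ‖η‖) ^ (-((d : ℝ) + 1))) :=
  integrable_one_add_norm (by simp)

/-- Decay of the oscillatory integral of `ψ h`, with a constant depending on `h` only through
the size of its derivatives on the support of the Schwartz function `ψ`. -/
lemma exists_one_add_norm_pow_mul_norm_fourier_le (ψ : 𝓢(RD d, ℂ)) (L K : ℕ) :
    ∃ C : ℝ, 0 ≤ C ∧ ∀ (h : RD d → V) (B : ℝ), 0 ≤ B → ContDiff ℝ ∞ h →
      (∀ i ≤ L, ∀ η ∈ tsupport ψ, ‖iteratedFDeriv ℝ i h η‖ ≤ B * (1 + ‖η‖) ^ K) →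
      ∀ z : RD d, (1 + ‖z‖) ^ L *
        ‖∫ η, Complex.exp (2 * Real.pi * Complex.I * ((⟪z, η⟫ : ℝ) : ℂ)) • (ψ η • h η)‖ ≤ C * B := by
  obtain ⟨C, hC0, hC⟩ := exists_norm_iteratedFDeriv_schwartz_smul_le (V := V) ψ L K
  set J : ℝ := ∫ η : RD d, (1 + ‖η‖) ^ (-((d : ℝ) + 1)) with hJ
  have hJ0 : 0 ≤ J := integral_nonneg fun η => by positivity
  refine ⟨2 ^ L * (2 * (2 ^ L * ((L + 1) * (C * J)))), by positivity, fun h B hB0 hh hB z => ?_⟩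
  have hsmooth : ContDiff ℝ ∞ (fun η => ψ η • h η) := (ψ.smooth ⊤).smul hh
  have hbound := hC h B hB0 hh hB
  have hint : ∀ p ≤ L, Integrable (fun η => ‖iteratedFDeriv ℝ p (fun η => ψ η • h η) η‖) :=
    fun p hp => (integrable_one_add_norm_rpow_neg.const_mul (C * B)).mono'
      ((hsmooth.continuous_iteratedFDeriv (mod_cast le_top)).norm.aestronglyMeasurable)
      (ae_of_all _ fun η => by simpa using hbound p hp η)
  have hintegral : ∀ p ≤ L, ∫ η, ‖iteratedFDeriv ℝ p (fun η => ψ η • h η) η‖ ≤ C * B * J := by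
    intro p hp
    rw [hJ, ← integral_const_mul]
    exact integral_mono (hint p hp) (integrable_one_add_norm_rpow_neg.const_mul _) (hbound p hp)
  have hfourier : ∫ η, Complex.exp (2 * Real.pi * Complex.I * ((⟪z, η⟫ : ℝ) : ℂ)) • (ψ η • h η)
      = FourierTransform.fourier (fun η => ψ η • h η) (-z) := by
    rw [Real.fourier_eq']
    refine integral_congr_ae (ae_of_all _ fun η => ?_)
    simp only [inner_neg_right, real_inner_comm z η]
    congr 2
    push_cast
    ring
  rw [hfourier]
  have hdecay : ∀ n ≤ L, ‖z‖ ^ n * ‖FourierTransform.fourier (fun η => ψ η • h η) (-z)‖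
      ≤ 2 ^ L * ((L + 1) * (C * B * J)) := by
    intro n hn
    have hF := Real.pow_mul_norm_iteratedFDeriv_fourier_le (K := 0) (N := (L : ℕ∞))
      (hsmooth.of_le (mod_cast le_top))
      (fun k q hk hq => by
        have hk0 : k = 0 := by simpa using hk
        subst hk0
        simpa using hint q (mod_cast hq)) (k := 0) (n := n) le_rfl (mod_cast hn) (-z)
    rw [norm_neg, norm_iteratedFDeriv_zero] at hF
    refine hF.trans ?_
    simp only [pow_zero, Nat.cast_zero, mul_zero, zero_add, one_mul, Finset.range_one,
      Finset.singleton_product, Finset.sum_map, Function.Embedding.coeFn_mk]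
    have hsum : ∑ q ∈ Finset.range (n + 1),
        ∫ η, ‖iteratedFDeriv ℝ q (fun η => ψ η • h η) η‖ ≤ (L + 1) * (C * B * J) := by
      calc _ ≤ ∑ _q ∈ Finset.range (n + 1), C * B * J :=
            Finset.sum_le_sum fun q hq => hintegral q (by have := Finset.mem_range.1 hq; omega)
        _ = (n + 1) * (C * B * J) := by simp
        _ ≤ (L + 1) * (C * B * J) := by gcongr
    exact mul_le_mul (pow_le_pow_right₀ one_le_two hn) hsum
      (Finset.sum_nonneg fun _ _ => integral_nonneg fun _ => norm_nonneg _) (by positivity)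
  have h0 := hdecay 0 (Nat.zero_le _)
  have hL := hdecay L le_rfl
  have hpow : (1 + ‖z‖) ^ L ≤ 2 ^ L * (1 + ‖z‖ ^ L) := by
    refine (add_pow_le zero_le_one (norm_nonneg z) L).trans ?_
    rw [one_pow]
    gcongr
    · norm_num
    · omega
  rw [pow_zero] at h0
  set T := ‖FourierTransform.fourier (fun η => ψ η • h η) (-z)‖
  calc (1 + ‖z‖) ^ L * T ≤ 2 ^ L * (1 + ‖z‖ ^ L) * T := by gcongr
    _ = 2 ^ L * (1 * T + ‖z‖ ^ L * T) := by ring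
    _ ≤ 2 ^ L * (2 ^ L * ((L + 1) * (C * B * J)) + 2 ^ L * ((L + 1) * (C * B * J))) := by
      gcongr
    _ = _ := by ring

end FourierDecay

section Symbol

variable {d : ℕ}

/-- Joint smoothness of the iterated derivatives of a symbol in the space variable. -/
lemma contDiff_iteratedFDeriv_left {a : RD d → RD d → ℂ}
    (ha : ContDiff ℝ ∞ (fun p : RD d × RD d => a p.1 p.2)) (n : ℕ) :
    ContDiff ℝ ∞ (fun p : RD d × RD d => iteratedFDeriv ℝ n (fun x => a x p.2) p.1) := by
  have h : ∀ p : RD d × RD d, iteratedFDeriv ℝ n (fun x => a x p.2) p.1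
      = (iteratedFDeriv ℝ n (fun q : RD d × RD d => a q.1 q.2) p).compContinuousLinearMap
          (fun _ => ContinuousLinearMap.inl ℝ (RD d) (RD d)) := by
    intro p
    have hshift : ContDiff ℝ n (fun q : RD d × RD d => a (((0, p.2) : RD d × RD d) + q).1
        (((0, p.2) : RD d × RD d) + q).2) :=
      (ha.of_le (mod_cast le_top)).comp (contDiff_const.add contDiff_id)
    have hc := (ContinuousLinearMap.inl ℝ (RD d) (RD d)).iteratedFDeriv_comp_right hshift p.1 le_rfl
    rw [iteratedFDeriv_comp_add_left n (0, p.2)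
      (f := fun q : RD d × RD d => a q.1 q.2)] at hc
    simpa [Function.comp_def] using hc
  simp_rw [h]
  exact (ContinuousMultilinearMap.compContinuousLinearMapL (F := ℂ)
    (fun _ : Fin n => ContinuousLinearMap.inl ℝ (RD d) (RD d))).contDiff.comp
    (ha.iteratedFDeriv_right (mod_cast le_top))

lemma rpow_le_two_pow_mul_pow {q Q s : ℝ} {K : ℕ} (hq : 1 / 2 ≤ q) (hqQ : q ≤ Q) (hQ : 1 ≤ Q)
    (hs : |s| ≤ K) : q ^ s ≤ 2 ^ K * Q ^ K := by
  have hq0 : 0 < q := by linarith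
  rw [abs_le] at hs
  rcases le_or_gt 0 s with h0 | h0
  · calc q ^ s ≤ Q ^ s := Real.rpow_le_rpow hq0.le hqQ h0
      _ ≤ Q ^ (K : ℝ) := Real.rpow_le_rpow_of_exponent_le hQ hs.2
      _ = 1 * Q ^ K := by rw [Real.rpow_natCast, one_mul]
      _ ≤ 2 ^ K * Q ^ K := by
        gcongr
        exact one_le_pow₀ one_le_two
  · calc q ^ s ≤ (1 / 2) ^ s := Real.rpow_le_rpow_of_nonpos (by norm_num) hq h0.le
      _ = 2 ^ (-s) := by rw [one_div, Real.inv_rpow zero_le_two, Real.rpow_neg zero_le_two]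
      _ ≤ 2 ^ (K : ℝ) := Real.rpow_le_rpow_of_exponent_le one_le_two (by linarith [hs.1])
      _ = 2 ^ K * 1 := by rw [Real.rpow_natCast, mul_one]
      _ ≤ 2 ^ K * Q ^ K := by
        gcongr
        exact one_le_pow₀ hQ

/-- Derivative bounds for a dyadically rescaled symbol, away from low frequencies. -/
lemma exists_norm_iteratedFDeriv_rescaled_symbol_le {m : ℝ} {a : RD d → RD d → ℂ}
    (ha : IsSymbolS11 d m a) (n L : ℕ) :
    ∃ (C : ℝ) (K : ℕ), 0 ≤ C ∧ ∀ (k : ℕ) (u η : RD d), (2 : ℝ) ^ k / 2 ≤ 1 + (2 : ℝ) ^ k * ‖η‖ →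
      ∀ i ≤ L, ‖iteratedFDeriv ℝ i
          (fun η => iteratedFDeriv ℝ n (fun x => a x ((2 : ℝ) ^ k • η)) u) η‖
        ≤ C * (2 : ℝ) ^ ((k : ℝ) * (m + n)) * (1 + ‖η‖) ^ K := by
  choose c hc using fun α => ha.2 α n
  set K : ℕ := ⌈|m|⌉₊ + L + n with hK
  set c₀ : ℝ := ∑ α ∈ Finset.range (L + 1), |c α|
  refine ⟨c₀ * 2 ^ K, K, by positivity, fun k u η hη i hi => ?_⟩
  have hsm : ContDiff ℝ i (fun ξ => iteratedFDeriv ℝ n (fun x => a x ξ) u) :=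
    ((contDiff_iteratedFDeriv_left ha.1 n).comp
      (contDiff_const.prodMk contDiff_id : ContDiff ℝ ∞ fun ξ : RD d => (u, ξ))).of_le
      (mod_cast le_top)
  rw [congrFun (iteratedFDeriv_comp_const_smul ((2 : ℝ) ^ k) hsm) η, norm_smul, norm_pow, norm_pow,
    Real.norm_ofNat]
  have h2k : (0 : ℝ) < 2 ^ k := by positivity
  have h2k1 : (1 : ℝ) ≤ 2 ^ k := one_le_pow₀ one_le_two
  have hci : c i ≤ c₀ := (le_abs_self _).trans
    (Finset.single_le_sum (f := fun α => |c α|) (fun _ _ => abs_nonneg _)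
      (Finset.mem_range.2 (Nat.lt_succ_of_le hi)))
  set s : ℝ := m - i + n
  have hs : |s| ≤ K := by
    have h2 : (i : ℝ) ≤ L := mod_cast hi
    have h3 : (0 : ℝ) ≤ i := Nat.cast_nonneg i
    have h4 : (0 : ℝ) ≤ n := Nat.cast_nonneg n
    have h5 := Nat.le_ceil |m|
    have h6 := neg_abs_le m
    have h7 := le_abs_self m
    rw [hK, abs_le]
    push_cast
    constructor <;> linarith
  set q : ℝ := (1 + (2 : ℝ) ^ k * ‖η‖) / 2 ^ k
  have hq1 : 1 / 2 ≤ q := by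
    rw [le_div_iff₀ h2k]
    linarith
  have hq2 : q ≤ 1 + ‖η‖ := by
    rw [div_le_iff₀ h2k]
    linarith
  have hfac : (1 + ‖(2 : ℝ) ^ k • η‖) ^ s = q ^ s * (2 : ℝ) ^ ((k : ℝ) * s) := by
    have : 1 + ‖(2 : ℝ) ^ k • η‖ = q * 2 ^ k := by
      rw [norm_smul, norm_pow, Real.norm_ofNat, div_mul_cancel₀ _ h2k.ne']
    rw [this, Real.mul_rpow (by linarith) h2k.le, ← Real.rpow_natCast, ← Real.rpow_mul zero_le_two]
  have hexp : ((2 : ℝ) ^ k) ^ i * (2 : ℝ) ^ ((k : ℝ) * s) = (2 : ℝ) ^ ((k : ℝ) * (m + n)) := by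
    rw [← pow_mul, ← Real.rpow_natCast, ← Real.rpow_add zero_lt_two]
    congr 1
    push_cast
    ring
  have hqs := rpow_le_two_pow_mul_pow hq1 hq2 (by linarith [norm_nonneg η]) hs
  have hq0 : 0 ≤ q ^ s := Real.rpow_nonneg (by linarith) _
  have hc₀ : 0 ≤ c₀ := Finset.sum_nonneg fun _ _ => abs_nonneg _
  calc ((2 : ℝ) ^ k) ^ i *
        ‖iteratedFDeriv ℝ i (fun ξ => iteratedFDeriv ℝ n (fun x => a x ξ) u) ((2 : ℝ) ^ k • η)‖
      ≤ ((2 : ℝ) ^ k) ^ i * (c i * (1 + ‖(2 : ℝ) ^ k • η‖) ^ s) := by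
        gcongr
        exact hc i u _
    _ ≤ ((2 : ℝ) ^ k) ^ i * (c₀ * (q ^ s * (2 : ℝ) ^ ((k : ℝ) * s))) := by
        rw [hfac]
        gcongr
    _ = c₀ * q ^ s * (2 : ℝ) ^ ((k : ℝ) * (m + n)) := by rw [← hexp]; ring
    _ ≤ c₀ * (2 ^ K * (1 + ‖η‖) ^ K) * (2 : ℝ) ^ ((k : ℝ) * (m + n)) := by gcongr
    _ = _ := by ring

/-- Interchanging the frequency integral with the Taylor remainder integral. -/
lemma norm_integral_taylor_remainder_le (f ψ : 𝓢(RD d, ℂ)) (n : ℕ)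
    {G : RD d → RD d → ContinuousMultilinearMap ℝ (fun _ : Fin (n + 1) => RD d) ℂ}
    (hG : Continuous (fun p : RD d × RD d => G p.1 p.2)) {e : RD d → ℂ} (he : Continuous e)
    (he1 : ∀ η, ‖e η‖ ≤ 1) {b : RD d → ℝ} (hb : Integrable b)
    (hGb : ∀ u η, ‖ψ η • G u η‖ ≤ b η) {A : ℝ} (hA : ∀ u, ‖∫ η, e η • ψ η • G u η‖ ≤ A)
    (x : RD d) (s : ℝ) :
    ‖∫ η, (∫ p, taylorWeight f n p * G (x - (p.2 * s) • p.1) η (fun _ => p.1)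
        ∂(cylinderMeasure d)) * ψ η * e η‖
      ≤ A * ∫ p, ‖p.1‖ ^ (n + 1) * ‖f p.1‖ ∂(cylinderMeasure d) := by
  have hw := continuous_taylorWeight f n
  have hψ := ψ.continuous
  have hint : Integrable (Function.uncurry fun (η : RD d) (p : RD d × ℝ) => taylorWeight f n p *
      (e η • ψ η • G (x - (p.2 * s) • p.1) η) (fun _ => p.1))
      (volume.prod (cylinderMeasure d)) := by
    refine (hb.mul_prod (integrable_norm_pow_mul_cylinder f (n + 1))).mono' ?_ ?_
    · refine Continuous.aestronglyMeasurable ?_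
      have hG' : Continuous fun q : RD d × RD d × ℝ => G (x - (q.2.2 * s) • q.2.1) q.1 :=
        hG.comp (f := fun q : RD d × RD d × ℝ => (x - (q.2.2 * s) • q.2.1, q.1)) (by fun_prop)
      refine (hw.comp continuous_snd).mul (Continuous.eval ?_ (by fun_prop))
      exact (he.comp continuous_fst).smul ((hψ.comp continuous_fst).smul hG')
    · have hmem : ∀ᵐ q ∂((volume : Measure (RD d)).prod (cylinderMeasure d)),
          q.2.2 ∈ Set.Icc (0 : ℝ) 1 := Measure.quasiMeasurePreserving_snd.ae ae_cylinderMeasure_mem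
      filter_upwards [hmem] with q hq
      have h1 := norm_taylorWeight_le f n hq
      have h2 := (e q.1 • ψ q.1 • G (x - (q.2.2 * s) • q.2.1) q.1).le_opNorm (fun _ => q.2.1)
      simp only [Finset.prod_const, Finset.card_univ, Fintype.card_fin] at h2
      have h3 : ‖e q.1 • ψ q.1 • G (x - (q.2.2 * s) • q.2.1) q.1‖ ≤ b q.1 := by
        rw [norm_smul]
        exact (mul_le_of_le_one_left (norm_nonneg _) (he1 _)).trans (hGb _ _)
      simp only [Function.uncurry]
      rw [norm_mul]
      calc _ ≤ ‖f q.2.1‖ * (b q.1 * ‖q.2.1‖ ^ (n + 1)) :=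
            mul_le_mul h1 (h2.trans (by gcongr)) (norm_nonneg _) (norm_nonneg _)
        _ = _ := by ring
  have hGint : ∀ u, Integrable fun η => e η • ψ η • G u η := by
    intro u
    refine hb.mono' ?_ (ae_of_all _ fun η => ?_)
    · have hG' : Continuous fun η => G u η :=
        hG.comp (f := fun η : RD d => (u, η)) (by fun_prop)
      exact (he.smul (hψ.smul hG')).aestronglyMeasurable
    · rw [norm_smul]
      exact (mul_le_of_le_one_left (norm_nonneg _) (he1 _)).trans (hGb _ _)
  have hswap : ∫ η, (∫ p, taylorWeight f n p * G (x - (p.2 * s) • p.1) η (fun _ => p.1)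
        ∂(cylinderMeasure d)) * ψ η * e η
      = ∫ p, taylorWeight f n p * (∫ η, e η • ψ η • G (x - (p.2 * s) • p.1) η) (fun _ => p.1)
        ∂(cylinderMeasure d) := by
    calc _ = ∫ η, ∫ p, taylorWeight f n p *
          (e η • ψ η • G (x - (p.2 * s) • p.1) η) (fun _ => p.1) ∂(cylinderMeasure d) := by
          refine integral_congr_ae (ae_of_all _ fun η => ?_)
          simp only [← integral_mul_const, smul_apply, smul_eq_mul]
          refine integral_congr_ae (ae_of_all _ fun p => ?_)
          ring
      _ = _ := by
          rw [integral_integral_swap hint]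
          refine integral_congr_ae (ae_of_all _ fun p => ?_)
          simp only [integral_const_mul, ContinuousMultilinearMap.integral_apply (hGint _)]
  rw [hswap, ← integral_const_mul]
  refine norm_integral_le_of_norm_le ((integrable_norm_pow_mul_cylinder f (n + 1)).const_mul A) ?_
  filter_upwards [ae_cylinderMeasure_mem] with p hp
  have h1 := norm_taylorWeight_le f n hp
  have h2 := (∫ η, e η • ψ η • G (x - (p.2 * s) • p.1) η).le_opNorm (fun _ => p.1)
  simp only [Finset.prod_const, Finset.card_univ, Fintype.card_fin] at h2
  rw [norm_mul]
  calc _ ≤ ‖f p.1‖ * (A * ‖p.1‖ ^ (n + 1)) :=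
        mul_le_mul h1 (h2.trans (by gcongr; exact hA _)) (norm_nonneg _) (norm_nonneg _)
    _ = _ := by ring

end Symbol

section Kernel

variable {d : ℕ}

set_option maxHeartbeats 1000000 in
/-- The kernel estimate for a frequency cutoff `ψ(2^{-k}·)` and a mollifier `2^{jd} f(2^j·)` whose
Fourier transform vanishes near the origin. -/
lemma exists_norm_kernel_le {m : ℝ} {a : RD d → RD d → ℂ} (ha : IsSymbolS11 d m a)
    (f ψ : 𝓢(RD d, ℂ)) (hf : ∀ᶠ ξ in nhds (0 : RD d), fourierS f ξ = 0) (n L : ℕ) :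
    ∃ C : ℝ, 0 ≤ C ∧ ∀ j k : ℕ, (∀ η ∈ tsupport ψ, (2 : ℝ) ^ k / 2 ≤ 1 + (2 : ℝ) ^ k * ‖η‖) →
      ∀ x z : RD d,
        ‖∫ ξ, (∫ y, f y * a (x - ((2 : ℝ) ^ j)⁻¹ • y) ξ) * ψ (((2 : ℝ) ^ k)⁻¹ • ξ) *
            Complex.exp (2 * Real.pi * Complex.I * ((⟪z, ξ⟫ : ℝ) : ℂ))‖
          ≤ C * (2 : ℝ) ^ ((k : ℝ) * (m + d)) * (2 : ℝ) ^ (-(((j : ℝ) - k) * (n + 1))) *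
            ((1 + (2 : ℝ) ^ k * ‖z‖) ^ L)⁻¹ := by
  obtain ⟨C₁, K, hC₁, hsymb⟩ := exists_norm_iteratedFDeriv_rescaled_symbol_le ha (n + 1) L
  obtain ⟨C₂, hC₂, hprod⟩ := exists_norm_iteratedFDeriv_schwartz_smul_le
    (V := ContinuousMultilinearMap ℝ (fun _ : Fin (n + 1) => RD d) ℂ) ψ L K
  obtain ⟨C₃, hC₃, hdecay⟩ := exists_one_add_norm_pow_mul_norm_fourier_le
    (V := ContinuousMultilinearMap ℝ (fun _ : Fin (n + 1) => RD d) ℂ) ψ L K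
  set J : ℝ := ∫ p, ‖p.1‖ ^ (n + 1) * ‖f p.1‖ ∂(cylinderMeasure d)
  have hJ : 0 ≤ J := integral_nonneg fun p => by positivity
  refine ⟨C₃ * C₁ * J, by positivity, fun j k hk x z => ?_⟩
  set B : ℝ := C₁ * (2 : ℝ) ^ ((k : ℝ) * (m + (n + 1 : ℕ))) with hB
  have hB0 : 0 ≤ B := by positivity
  set s : ℝ := ((2 : ℝ) ^ j)⁻¹ with hs
  set G : RD d → RD d → ContinuousMultilinearMap ℝ (fun _ : Fin (n + 1) => RD d) ℂ :=
    fun u η => iteratedFDeriv ℝ (n + 1) (fun x => a x ((2 : ℝ) ^ k • η)) u with hG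
  have hGsmooth : ContDiff ℝ ∞ (fun p : RD d × RD d => G p.1 p.2) :=
    (contDiff_iteratedFDeriv_left ha.1 (n + 1)).comp
      (contDiff_fst.prodMk (contDiff_snd.const_smul ((2 : ℝ) ^ k)))
  have hGu : ∀ u, ContDiff ℝ ∞ (G u) := fun u =>
    hGsmooth.comp (contDiff_const.prodMk contDiff_id : ContDiff ℝ ∞ fun ξ : RD d => (u, ξ))
  have hGbound : ∀ u, ∀ i ≤ L, ∀ η ∈ tsupport ψ,
      ‖iteratedFDeriv ℝ i (G u) η‖ ≤ B * (1 + ‖η‖) ^ K :=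
    fun u i hi η hη => hsymb k u η (hk η hη) i hi
  set z' : RD d := (2 : ℝ) ^ k • z with hz'
  set e : RD d → ℂ := fun η => Complex.exp (2 * Real.pi * Complex.I * ((⟪z', η⟫ : ℝ) : ℂ)) with he
  have he1 : ∀ η, ‖e η‖ ≤ 1 := by
    intro η
    have : 2 * Real.pi * Complex.I * ((⟪z', η⟫ : ℝ) : ℂ)
        = ((2 * Real.pi * ⟪z', η⟫ : ℝ) : ℂ) * Complex.I := by
      push_cast
      ring
    rw [he]
    simp only [this, Complex.norm_exp_ofReal_mul_I, le_refl]
  have hz'norm : ‖z'‖ = (2 : ℝ) ^ k * ‖z‖ := by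
    rw [hz', norm_smul, norm_pow, Real.norm_ofNat]
  have hmain := norm_integral_taylor_remainder_le f ψ n hGsmooth.continuous
    (e := e) (by fun_prop) he1
    (integrable_one_add_norm_rpow_neg.const_mul (C₂ * B))
    (fun u η => by
      simpa only [norm_iteratedFDeriv_zero] using
        hprod (G u) B hB0 (hGu u) (hGbound u) 0 (Nat.zero_le _) η)
    (A := C₃ * B * ((1 + (2 : ℝ) ^ k * ‖z‖) ^ L)⁻¹)
    (fun u => by
      rw [← div_eq_mul_inv, le_div_iff₀' (by positivity), ← hz'norm]
      exact hdecay (G u) B hB0 (hGu u) (hGbound u) z') x s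
  have hpoint : ∀ η, (∫ y, f y * a (x - s • y) ((2 : ℝ) ^ k • η)) = (((-s) ^ (n + 1) : ℝ) : ℂ) *
      ∫ p, taylorWeight f n p * G (x - (p.2 * s) • p.1) η (fun _ => p.1) ∂(cylinderMeasure d) := by
    intro η
    obtain ⟨c, hc⟩ := ha.2 0 (n + 1)
    refine integral_schwartz_mul_comp_sub_smul f hf (g := fun x => a x ((2 : ℝ) ^ k • η)) ?_
      (fun u => by simpa only [norm_iteratedFDeriv_zero] using hc u ((2 : ℝ) ^ k • η)) x s
    exact (ha.1.comp (contDiff_id.prodMk contDiff_const :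
      ContDiff ℝ ∞ fun x : RD d => (x, (2 : ℝ) ^ k • η))).of_le (mod_cast le_top)
  have h2k : (2 : ℝ) ^ k ≠ 0 := by positivity
  have hscale := Measure.integral_comp_inv_smul (volume : Measure (RD d))
    (fun η => (∫ y, f y * a (x - s • y) ((2 : ℝ) ^ k • η)) * ψ η * e η) ((2 : ℝ) ^ k)
  have hcancel : ∀ ξ : RD d, (2 : ℝ) ^ k • ((2 : ℝ) ^ k)⁻¹ • ξ = ξ := fun ξ => smul_inv_smul₀ h2k ξ
  have hphase : ∀ ξ : RD d, e (((2 : ℝ) ^ k)⁻¹ • ξ)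
      = Complex.exp (2 * Real.pi * Complex.I * ((⟪z, ξ⟫ : ℝ) : ℂ)) := by
    intro ξ
    simp only [he, hz', real_inner_smul_left, real_inner_smul_right, mul_inv_cancel_left₀ h2k]
  simp only [hcancel, hphase] at hscale
  rw [hscale, finrank_euclideanSpace_fin, norm_smul]
  simp only [hpoint, mul_assoc (((-s) ^ (n + 1) : ℝ) : ℂ)]
  rw [integral_const_mul, norm_mul, Complex.norm_real]
  have hsnorm : ‖(-s) ^ (n + 1)‖ = (2 : ℝ) ^ (-((j : ℝ) * (n + 1))) := by
    rw [norm_pow, norm_neg, hs, norm_inv, norm_pow, Real.norm_ofNat, inv_pow, ← pow_mul,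
      Real.rpow_neg zero_le_two, ← Real.rpow_natCast]
    push_cast
    rfl
  have hvol : ‖|((2 : ℝ) ^ k) ^ d|‖ = (2 : ℝ) ^ ((k : ℝ) * d) := by
    rw [norm_abs_eq_norm, norm_pow, norm_pow, Real.norm_ofNat, ← pow_mul, ← Real.rpow_natCast]
    push_cast
    rfl
  have hexp : (2 : ℝ) ^ ((k : ℝ) * d) * ((2 : ℝ) ^ (-((j : ℝ) * (n + 1))) *
      (2 : ℝ) ^ ((k : ℝ) * (m + (n + 1 : ℕ))))
      = (2 : ℝ) ^ ((k : ℝ) * (m + d)) * (2 : ℝ) ^ (-(((j : ℝ) - k) * (n + 1))) := by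
    rw [← Real.rpow_add zero_lt_two, ← Real.rpow_add zero_lt_two, ← Real.rpow_add zero_lt_two]
    congr 1
    push_cast
    ring
  rw [hsnorm, hvol]
  calc _ ≤ (2 : ℝ) ^ ((k : ℝ) * d) * ((2 : ℝ) ^ (-((j : ℝ) * (n + 1))) *
        (C₃ * B * ((1 + (2 : ℝ) ^ k * ‖z‖) ^ L)⁻¹ * J)) := by gcongr
    _ = C₃ * C₁ * J * ((2 : ℝ) ^ ((k : ℝ) * d) * ((2 : ℝ) ^ (-((j : ℝ) * (n + 1))) *
        (2 : ℝ) ^ ((k : ℝ) * (m + (n + 1 : ℕ))))) * ((1 + (2 : ℝ) ^ k * ‖z‖) ^ L)⁻¹ := by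
        rw [hB]
        ring
    _ = _ := by
        rw [hexp]
        ring

lemma LPData.eventually_fourierS_eq_zero (D : LPData d) :
    ∀ᶠ ξ in nhds (0 : RD d), fourierS D.φ ξ = 0 := by
  filter_upwards [Metric.ball_mem_nhds (0 : RD d) (by norm_num : (0 : ℝ) < 1 / 2)] with ξ hξ
  by_contra h
  exact absurd (D.supp_φ ξ h).1 (not_le.2 (by simpa using hξ))

lemma LPData.half_le_norm_of_mem_tsupport (D : LPData d) {η : RD d}
    (hη : η ∈ tsupport (fourierS D.φ)) : 1 / 2 ≤ ‖η‖ :=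
  closure_minimal (fun ξ hξ => (D.supp_φ ξ hξ).1)
    (isClosed_le continuous_const continuous_norm) hη

/-- Rescaling of the convolution with a Littlewood–Paley kernel of positive index. -/
lemma integral_LPkernel_succ_mul (D : LPData d) (j : ℕ) (g : RD d → ℂ) (x : RD d) :
    ∫ y, LPkernel D (j + 1) y * g (x - y)
      = ∫ y, D.φ y * g (x - ((2 : ℝ) ^ (j + 1))⁻¹ • y) := by
  have h2 : (2 : ℝ) ^ (j + 1) ≠ 0 := by positivity
  have h := Measure.integral_comp_smul (volume : Measure (RD d))
    (fun y => D.φ y * g (x - ((2 : ℝ) ^ (j + 1))⁻¹ • y)) ((2 : ℝ) ^ (j + 1))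
  simp only [inv_smul_smul₀ h2] at h
  simp only [LPkernel, mul_assoc]
  rw [integral_const_mul, h, finrank_euclideanSpace_fin, abs_of_pos (by positivity),
    Complex.real_smul, ← mul_assoc, ← Complex.ofReal_mul, pow_mul, mul_inv_cancel₀ (by positivity),
    Complex.ofReal_one, one_mul]

end Kernel

/-- the kernel estimate
`|W_{j,k}(x,y)| ≤ C 2^{k(m+d)} 2^{-(j-k)N} (1+2^k|x-y|)^{-M}` for `j ≥ 3`, `k ≤ j-3`. -/
theorem statement15 (d : ℕ) (hd : 1 ≤ d) (m : ℝ)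
    (D : LPData d) (a : RD d → RD d → ℂ) (ha : IsSymbolS11 d m a) :
    ∀ N M : ℝ, 0 < N → 0 < M → ∃ C : ℝ, ∀ j k : ℕ, 3 ≤ j → k + 3 ≤ j →
      ∀ x y : RD d,
        ‖Wkernel D a j k x y‖ ≤
          C * (2:ℝ)^((k:ℝ)*(m+(d:ℝ))) * (2:ℝ)^(-(((j:ℝ)-(k:ℝ))*N)) *
            (1 + (2:ℝ)^k * ‖x - y‖)^(-M) := by
  intro N M hN hM
  set n : ℕ := ⌈N⌉₊
  set L : ℕ := ⌈M⌉₊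
  have hf := D.eventually_fourierS_eq_zero
  obtain ⟨C₁, hC₁, hhigh⟩ := exists_norm_kernel_le ha D.φ (fourierS D.φ) hf n L
  obtain ⟨C₀, hC₀, hlow⟩ := exists_norm_kernel_le ha D.φ (fourierS D.Φ) hf n L
  refine ⟨C₀ + C₁, fun j k hj hjk x y => ?_⟩
  obtain ⟨i, rfl⟩ : ∃ i, j = i + 1 := ⟨j - 1, by omega⟩
  have hkernel : ‖Wkernel D a (i + 1) k x y‖ ≤ (C₀ + C₁) * (2 : ℝ) ^ ((k : ℝ) * (m + d)) *
      (2 : ℝ) ^ (-((((i + 1 : ℕ) : ℝ) - k) * (n + 1))) *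
      ((1 + (2 : ℝ) ^ k * ‖x - y‖) ^ L)⁻¹ := by
    have hconv : ∀ ξ, ∫ u, LPkernel D (i + 1) u * a (x - u) ξ
        = ∫ u, D.φ u * a (x - ((2 : ℝ) ^ (i + 1))⁻¹ • u) ξ :=
      fun ξ => integral_LPkernel_succ_mul D i (fun u => a u ξ) x
    simp only [Wkernel, symbolPiece, hconv]
    rcases k with _ | k
    · have hLP : ∀ ξ, LPhat D 0 ξ = fourierS D.Φ (((2 : ℝ) ^ 0)⁻¹ • ξ) := by simp [LPhat]
      simp only [hLP]
      refine (hlow (i + 1) 0 (fun η _ => ?_) x (x - y)).trans ?_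
      · have := norm_nonneg η
        norm_num
        linarith
      · gcongr
        linarith
    · refine (hhigh (i + 1) (k + 1) (fun η hη => ?_) x (x - y)).trans ?_
      · have h1 := D.half_le_norm_of_mem_tsupport hη
        have h2 : (0 : ℝ) < 2 ^ (k + 1) := by positivity
        nlinarith
      · gcongr
        linarith
  refine hkernel.trans ?_
  have hbase : (1 : ℝ) ≤ 1 + (2 : ℝ) ^ k * ‖x - y‖ := le_add_of_nonneg_right (by positivity)
  have hM' : ((1 + (2 : ℝ) ^ k * ‖x - y‖) ^ L)⁻¹ ≤ (1 + (2 : ℝ) ^ k * ‖x - y‖) ^ (-M) := by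
    rw [← Real.rpow_natCast, ← Real.rpow_neg (by linarith)]
    exact Real.rpow_le_rpow_of_exponent_le hbase (neg_le_neg (Nat.le_ceil M))
  have hN' : (2 : ℝ) ^ (-((((i + 1 : ℕ) : ℝ) - k) * (n + 1)))
      ≤ (2 : ℝ) ^ (-((((i + 1 : ℕ) : ℝ) - k) * N)) := by
    have hjk' : (0 : ℝ) ≤ ((i + 1 : ℕ) : ℝ) - k := by
      have : (k : ℝ) ≤ ((i + 1 : ℕ) : ℝ) := by exact_mod_cast (by omega : k ≤ i + 1)
      linarith
    refine Real.rpow_le_rpow_of_exponent_le one_le_two (neg_le_neg ?_)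
    exact mul_le_mul_of_nonneg_left (by linarith [Nat.le_ceil N]) hjk'
  gcongr

end
end
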